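/- arXiv:1705.10592 — 4 statements merged into one kernel-verified Lean document; each statement's English description precedes it below -/
import Mathlib

section
/- Let q be a prime power, m, l ≥ 1 and n = l·m. Let 0 ≤ k_2 < k_1 ≤ m and t_0, ρ_0 ≥ 0 be integers with 2t_0 + ρ_0 = m − k_1, and set ℓ = l(k_1 − k_2). Let n − ρ_0 = d_h < d_{h−1} < … < d_1 ≤ n be integers and set α = lcm{ l(d_j − 2t_0 − k_2) − (l−1)n : j = 1,…,h }. Then there exists a coset coding scheme (C_S) with message set F_{q^m}^{α×ℓ} and codeword set F_{q^m}^{α×n} such that: (1) for all integers t, ρ ≥ 0 with 2t + ρ ≤ m − k_1, the scheme is universally t-error and ρ-erasure-correcting; (2) for every integer μ with 0 ≤ μ ≤ k_2, the scheme is universally secure under μ observations; (3) for every j ∈ {1,…,h} and every full-rank A ∈ F_q^{d_j×n} there exist preprocessing functions E_{A,i} : F_{q^m}^α → F_{q^m}^{ℓα/(l(d_j − 2t_0 − k_2) − (l−1)n)} (i = 1,…,d_j) that are t_0-error-correcting with respect to the scheme; in particular CO(A) = ℓ( l(2t_0 + k_2) + (l−1)(n − d_j) ) / ( l(d_j − 2t_0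 − k_2) − (l−1)n ). -/
open Matrix

/-- The rank over `Fq` of a row vector with entries in `Fqm`. -/
noncomputable def rkVec (Fq : Type*) [Field Fq] {Fqm : Type*} [Field Fqm] [Algebra Fq Fqm]
    {n : ℕ} (v : Fin n → Fqm) : ℕ :=
  Module.finrank Fq (Submodule.span Fq (Set.range v))

/-- The rank over `Fq` of a matrix with entries in `Fqm`: the dimension over `Fq`
of the `Fq`-span of its columns. -/
noncomputable def rkMat (Fq : Type*) [Field Fq] {Fqm : Type*} [Field Fqm] [Algebra Fq Fqm]
    {a N : ℕ} (E : Matrix (Fin a) (Fin N) Fqm) : ℕ :=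
  Module.finrank Fq (Submodule.span Fq (Set.range fun j : Fin N => fun i : Fin a => E i j))

/-- The relative minimum rank distance `d_R(C1, C2)` of (sets of) codewords. -/
noncomputable def dRel (Fq : Type*) [Field Fq] {Fqm : Type*} [Field Fqm] [Algebra Fq Fqm]
    {n : ℕ} (C1 C2 : Set (Fin n → Fqm)) : ℕ :=
  sInf {r | ∃ c ∈ C1, c ∉ C2 ∧ rkVec Fq c = r}

/-- The dual code w.r.t. the standard bilinear form `⟨x,y⟩ = ∑ i, x i * y i`. -/
def dualCode {K : Type*} [Field K] {n : ℕ} (C : Set (Fin n → K)) : Submodule K (Fin n → K) where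
  carrier := {y | ∀ x ∈ C, ∑ i, x i * y i = 0}
  zero_mem' := by intro x hx; simp
  add_mem' := by
    intro a b ha hb x hx
    have h1 := ha x hx
    have h2 := hb x hx
    simp only [Pi.add_apply, mul_add, Finset.sum_add_distrib, h1, h2, add_zero]
  smul_mem' := by
    intro c y hy x hx
    have h := hy x hx
    simp only [Pi.smul_apply, smul_eq_mul]
    calc ∑ i, x i * (c * y i) = c * ∑ i, x i * y i := by
          rw [Finset.mul_sum]; congr 1; ext i; ring
      _ = 0 := by rw [h, mul_zero]

/-- A coset coding scheme `CS` (a disjoint family of nonempty sets of codeword matrices)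
is universally `t`-error and `ρ`-erasure-correcting. -/
def UnivCorrecting (Fq : Type*) [Field Fq] {Fqm : Type*} [Field Fqm] [Algebra Fq Fqm]
    {α n ℓ : ℕ} (t ρ : ℕ)
    (CS : Matrix (Fin α) (Fin ℓ) Fqm → Set (Matrix (Fin α) (Fin n) Fqm)) : Prop :=
  ∀ N : ℕ, 1 ≤ N → ∀ A : Matrix (Fin N) (Fin n) Fq, n - ρ ≤ A.rank →
    ∃ D : Matrix (Fin α) (Fin N) Fqm → Matrix (Fin α) (Fin ℓ) Fqm,
      ∀ S X E, X ∈ CS S → rkMat Fq E ≤ t →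
        D (X * (A.map (algebraMap Fq Fqm))ᵀ + E) = S

/-- A coset coding scheme is universally secure under `μ` observations: for a uniform
message and codeword uniform on `CS S`, the distribution of `X Bᵀ` does not depend on `S`. -/
def UnivSecure (Fq : Type*) [Field Fq] {Fqm : Type*} [Field Fqm] [Algebra Fq Fqm]
    {α n ℓ : ℕ} (μ : ℕ)
    (CS : Matrix (Fin α) (Fin ℓ) Fqm → Set (Matrix (Fin α) (Fin n) Fqm)) : Prop :=
  ∀ (B : Matrix (Fin μ) (Fin n) Fq) (S₁ S₂ : Matrix (Fin α) (Fin ℓ) Fqm)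
    (W : Matrix (Fin α) (Fin μ) Fqm),
    ({X ∈ CS S₁ | X * (B.map (algebraMap Fq Fqm))ᵀ = W}).ncard * (CS S₂).ncard
      = ({X ∈ CS S₂ | X * (B.map (algebraMap Fq Fqm))ᵀ = W}).ncard * (CS S₁).ncard

/-- Preprocessing functions `EA i` (applied to the columns `C aᵢᵀ + eᵢ`) are
`t`-error-correcting with respect to the coset coding scheme `CS`. -/
def PreprocCorrecting (Fq : Type*) [Field Fq] {Fqm : Type*} [Field Fqm] [Algebra Fq Fqm]
    {α n ℓ d : ℕ} (t : ℕ) (A : Matrix (Fin d) (Fin n) Fq) {β : Fin d → ℕ}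
    (EA : ∀ i : Fin d, (Fin α → Fqm) → (Fin (β i) → Fqm))
    (CS : Matrix (Fin α) (Fin ℓ) Fqm → Set (Matrix (Fin α) (Fin n) Fqm)) : Prop :=
  ∃ D : (∀ i : Fin d, Fin (β i) → Fqm) → Matrix (Fin α) (Fin ℓ) Fqm,
    ∀ S C E, C ∈ CS S → rkMat Fq E ≤ t →
      D (fun i => EA i (fun r => (C * (A.map (algebraMap Fq Fqm))ᵀ) r i + E r i)) = S

section LinearizedPolynomials

variable {Fq K : Type*} [Field Fq] [Field K] [Algebra Fq K] [Fintype Fq]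

/-- A linearized polynomial with `r` coefficients that vanishes on an `Fq`-subspace of dimension
at least `r` is zero. -/
theorem linearized_coeff_eq_zero [Fintype K] {r : ℕ} (U : Submodule Fq K)
    (hr : r ≤ Module.finrank Fq U) (f : ℕ → K)
    (hf : ∀ x ∈ U, ∑ s ∈ Finset.range r, f s * (FiniteField.frobeniusAlgHom Fq K ^ s) x = 0) :
    ∀ s < r, f s = 0 := by
  classical
  intro s hs
  have hq : 1 < Fintype.card Fq := Fintype.one_lt_card
  set q := Fintype.card Fq with hqdef
  let p : Polynomial K := ∑ s ∈ Finset.range r, Polynomial.monomial (q ^ s) (f s)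
  have hdeg : p.natDegree ≤ q ^ (r - 1) := by
    refine Polynomial.natDegree_sum_le_of_forall_le _ _ fun i hi => ?_
    refine (Polynomial.natDegree_monomial_le _).trans ?_
    exact Nat.pow_le_pow_right (by omega) (by have := Finset.mem_range.1 hi; omega)
  have hcard : Fintype.card U = q ^ Module.finrank Fq U := Module.card_eq_pow_finrank
  have hp : p = 0 := by
    refine Polynomial.eq_zero_of_natDegree_lt_card_of_eval_eq_zero p
      (f := fun x : U => (x : K)) Subtype.val_injective (fun x => ?_) ?_
    · rw [← hf x x.2]
      simp [p, Polynomial.eval_finsetSum, AlgHom.coe_pow, FiniteField.coe_frobeniusAlgHom,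
        pow_iterate, q]
    · rw [hcard]
      exact hdeg.trans_lt (Nat.pow_lt_pow_right hq (by omega))
  have hcoeff : p.coeff (q ^ s) = f s := by
    simp only [p, Polynomial.finsetSum_coeff, Polynomial.coeff_monomial]
    rw [Finset.sum_eq_single s]
    · simp
    · intro b _ hb
      rw [if_neg fun h => hb (Nat.pow_right_injective hq h)]
    · intro h
      exact absurd (Finset.mem_range.2 hs) h
  rw [← hcoeff, hp, Polynomial.coeff_zero]

/-- The Moore matrix of a linearly independent family has trivial left kernel. -/
theorem moore_eq_zero [Fintype K] {r : ℕ} {u : Fin r → K} (hu : LinearIndependent Fq u)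
    (w : Fin r → K)
    (hw : ∀ s < r, ∑ a, w a * (FiniteField.frobeniusAlgHom Fq K ^ s) (u a) = 0) : w = 0 := by
  let M : Matrix (Fin r) (Fin r) K :=
    Matrix.of fun a s => (FiniteField.frobeniusAlgHom Fq K ^ (s : ℕ)) (u a)
  have hdet : M.det ≠ 0 := by
    intro h0
    obtain ⟨v, hv, hMv⟩ := Matrix.exists_mulVec_eq_zero_iff.2 h0
    apply hv
    let f : ℕ → K := fun s => if h : s < r then v ⟨s, h⟩ else 0
    let T : K →ₗ[Fq] K := ∑ s ∈ Finset.range r,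
      f s • (FiniteField.frobeniusAlgHom Fq K ^ s).toLinearMap
    have hT : ∀ x, T x = ∑ s ∈ Finset.range r, f s * (FiniteField.frobeniusAlgHom Fq K ^ s) x := by
      intro x
      simp [T, LinearMap.sum_apply]
    have hle : Submodule.span Fq (Set.range u) ≤ LinearMap.ker T := by
      rw [Submodule.span_le]
      rintro _ ⟨a, rfl⟩
      have := congrFun hMv a
      simp only [Matrix.mulVec, dotProduct, M, Matrix.of_apply, Pi.zero_apply] at this
      rw [SetLike.mem_coe, LinearMap.mem_ker, hT, ← this, Finset.sum_range]
      refine Finset.sum_congr rfl fun s _ => ?_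
      simp [f, mul_comm]
    have hz := linearized_coeff_eq_zero (r := r) (Submodule.span Fq (Set.range u))
      (by rw [finrank_span_eq_card hu, Fintype.card_fin]) f
      (fun x hx => by rw [← hT]; exact hle hx)
    funext s
    have := hz s s.2
    simpa [f] using this
  refine Matrix.eq_zero_of_vecMul_eq_zero hdet (funext fun s => ?_)
  exact hw s s.2

/-- A vector of rank at most `k` that is orthogonal to the first `k` Frobenius twists of a linearly
independent family is zero. -/
theorem eq_zero_of_orthogonal_frobenius [Fintype K] {ι : Type*} [Fintype ι] {k : ℕ}
    {g : ι → K} (hg : LinearIndependent Fq g) (y : ι → K)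
    (hy : Module.finrank Fq (Submodule.span Fq (Set.range y)) ≤ k)
    (h : ∀ s < k, ∑ i, y i * (FiniteField.frobeniusAlgHom Fq K ^ s) (g i) = 0) : y = 0 := by
  set φ := FiniteField.frobeniusAlgHom Fq K
  have h' : ∀ s < k, ∑ i, (φ ^ s) (y i) * (φ ^ (k - 1)) (g i) = 0 := by
    intro s hs
    have := congrArg (φ ^ s) (h (k - 1 - s) (by omega))
    rw [map_zero, map_sum] at this
    rw [← this]
    refine Finset.sum_congr rfl fun i _ => ?_
    rw [map_mul, ← AlgHom.mul_apply, ← pow_add]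
    congr 3
    omega
  have hg' : LinearIndependent Fq fun i => (φ ^ (k - 1)) (g i) :=
    hg.map' (φ ^ (k - 1)).toLinearMap
      (LinearMap.ker_eq_bot_of_injective (φ ^ (k - 1)).toRingHom.injective)
  let b := Module.finBasis Fq (Submodule.span Fq (Set.range y))
  let Q : ι → Fin _ → Fq := fun i => b.repr ⟨y i, Submodule.subset_span ⟨i, rfl⟩⟩
  have hQ : ∀ i, y i = ∑ c, Q i c • (b c : K) := by
    intro i
    have := congrArg (Submodule.subtype _) (b.sum_repr ⟨y i, Submodule.subset_span ⟨i, rfl⟩⟩)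
    rw [map_sum] at this
    exact this.symm
  have hb : LinearIndependent Fq fun c => (b c : K) :=
    b.linearIndependent.map' (Submodule.subtype _) (Submodule.ker_subtype _)
  have hw := moore_eq_zero hb (fun c => ∑ i, Q i c • (φ ^ (k - 1)) (g i)) (by
    intro s hs
    rw [← h' s (by omega)]
    simp_rw [Finset.sum_mul]
    rw [Finset.sum_comm]
    refine Finset.sum_congr rfl fun i _ => ?_
    rw [hQ i, map_sum, Finset.sum_mul]
    refine Finset.sum_congr rfl fun c _ => ?_
    rw [map_smul, smul_mul_assoc, smul_mul_assoc, mul_comm])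
  funext i
  rw [hQ i, Pi.zero_apply]
  refine Finset.sum_eq_zero fun c _ => ?_
  rw [Fintype.linearIndependent_iff.1 hg' (fun i => Q i c) (congrFun hw c) i, zero_smul]

end LinearizedPolynomials

section GabidulinPowers

variable {Fq K : Type*} [Field Fq] [Field K] [Algebra Fq K] [Fintype Fq] {l m n : ℕ}

/-- The codeword of the `l`-fold cartesian product of a Gabidulin code, evaluated at `g`, whose
`b`-th component is given by the linearized polynomial with coefficients `f b`. -/
noncomputable def gabidulinWord (g : Fin m → K) (e : Fin n ≃ Fin l × Fin m) (f : Fin l → ℕ → K) :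
    Fin n → K :=
  fun c => ∑ s ∈ Finset.range m,
    f (e c).1 s * (FiniteField.frobeniusAlgHom Fq K ^ s) (g (e c).2)

theorem gabidulinWord_sub (g : Fin m → K) (e : Fin n ≃ Fin l × Fin m) (f f' : Fin l → ℕ → K) :
    gabidulinWord (Fq := Fq) g e (f - f') =
      gabidulinWord (Fq := Fq) g e f - gabidulinWord (Fq := Fq) g e f' := by
  funext c
  simp [gabidulinWord, sub_mul]

theorem gabidulinWord_add (g : Fin m → K) (e : Fin n ≃ Fin l × Fin m) (f f' : Fin l → ℕ → K) :
    gabidulinWord (Fq := Fq) g e (f + f') =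
      gabidulinWord (Fq := Fq) g e f + gabidulinWord (Fq := Fq) g e f' := by
  funext c
  simp [gabidulinWord, add_mul, Finset.sum_add_distrib]

theorem gabidulinWord_smul (g : Fin m → K) (e : Fin n ≃ Fin l × Fin m) (a : K)
    (f : Fin l → ℕ → K) :
    gabidulinWord (Fq := Fq) g e (a • f) = a • gabidulinWord (Fq := Fq) g e f := by
  funext c
  simp [gabidulinWord, Finset.mul_sum, mul_assoc]

/-- A power of a `k`-dimensional Gabidulin code has minimum rank distance greater than `m - k`. -/
theorem eq_zero_of_rkVec_gabidulinWord [Fintype K] (hfin : Module.finrank Fq K = m)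
    {g : Fin m → K} (hg : Submodule.span Fq (Set.range g) = ⊤) (e : Fin n ≃ Fin l × Fin m)
    {k : ℕ} (f : Fin l → ℕ → K) (hf : ∀ b s, k ≤ s → f b s = 0)
    (hrk : rkVec Fq (gabidulinWord (Fq := Fq) g e f) + k ≤ m) : f = 0 := by
  funext b s
  by_cases hs : k ≤ s
  · exact hf b s hs
  let T : K →ₗ[Fq] K := ∑ s ∈ Finset.range m,
    f b s • (FiniteField.frobeniusAlgHom Fq K ^ s).toLinearMap
  have hT : ∀ x, T x = ∑ s ∈ Finset.range m, f b s * (FiniteField.frobeniusAlgHom Fq K ^ s) x := by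
    intro x
    simp [T, LinearMap.sum_apply]
  have hrange : LinearMap.range T ≤
      Submodule.span Fq (Set.range (gabidulinWord (Fq := Fq) g e f)) := by
    rw [LinearMap.range_eq_map, ← hg, Submodule.map_span_le]
    rintro _ ⟨i, rfl⟩
    refine Submodule.subset_span ⟨e.symm (b, i), ?_⟩
    simp [hT, gabidulinWord]
  have h1 : Module.finrank Fq (LinearMap.range T) ≤ _ := Submodule.finrank_mono hrange
  have h2 := LinearMap.finrank_range_add_finrank_ker T
  refine linearized_coeff_eq_zero (r := k) (LinearMap.ker T) ?_ (f b) ?_ s (by omega)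
  · unfold rkVec at hrk
    omega
  · intro x hx
    rw [← LinearMap.mem_ker.1 hx, hT]
    refine Finset.sum_subset (Finset.range_subset_range.2 (by omega)) fun i _ hi => ?_
    rw [hf b i (by simpa using hi), zero_mul]

/-- Any `k` observations of a word agree with those of a word from the power of the
`k`-dimensional Gabidulin code. -/
theorem exists_gabidulinWord_mulVec_eq [Fintype K] {g : Fin m → K} (hg : LinearIndependent Fq g)
    (e : Fin n ≃ Fin l × Fin m) {k μ : ℕ} (hμ : μ ≤ k) (hkm : k ≤ m)
    (B : Matrix (Fin μ) (Fin n) Fq) (v : Fin n → K) :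
    ∃ f : Fin l → ℕ → K, (∀ b s, k ≤ s → f b s = 0) ∧
      (B.map (algebraMap Fq K)) *ᵥ gabidulinWord (Fq := Fq) g e f =
        (B.map (algebraMap Fq K)) *ᵥ v := by
  let P : Submodule K (Fin μ → K) :=
    { carrier := {w | ∃ f : Fin l → ℕ → K, (∀ b s, k ≤ s → f b s = 0) ∧
        (B.map (algebraMap Fq K)) *ᵥ gabidulinWord (Fq := Fq) g e f = w}
      add_mem' := by
        rintro _ _ ⟨f, hf, rfl⟩ ⟨f', hf', rfl⟩
        exact ⟨f + f', fun b s h => by simp [hf b s h, hf' b s h],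
          by rw [gabidulinWord_add, Matrix.mulVec_add]⟩
      zero_mem' := ⟨0, by simp, by
        rw [show gabidulinWord (Fq := Fq) g e 0 = 0 by funext c; simp [gabidulinWord],
          Matrix.mulVec_zero]⟩
      smul_mem' := by
        rintro a _ ⟨f, hf, rfl⟩
        exact ⟨a • f, fun b s h => by simp [hf b s h],
          by rw [gabidulinWord_smul, Matrix.mulVec_smul]⟩ }
  suffices h : (B.map (algebraMap Fq K)) *ᵥ v ∈ P from h
  by_contra hv
  obtain ⟨L, hL, hPL⟩ := Submodule.exists_le_ker_of_notMem hv
  apply hL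
  classical
  let w : Fin μ → K := fun a => L (Pi.single a 1)
  have hLw : ∀ x, L x = w ⬝ᵥ x := by
    intro x
    conv_lhs => rw [← Finset.univ_sum_single x, map_sum]
    refine Finset.sum_congr rfl fun a _ => ?_
    rw [show Pi.single a (x a) = x a • (Pi.single a 1 : Fin μ → K) by
      rw [← Pi.single_smul, smul_eq_mul, mul_one], map_smul, smul_eq_mul, mul_comm]
  set y : Fin n → K := w ᵥ* B.map (algebraMap Fq K) with hy
  have hyz : ∀ b, (fun i => y (e.symm (b, i))) = 0 := by
    intro b
    refine eq_zero_of_orthogonal_frobenius (k := k) hg _ ?_ fun s hs => ?_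
    · have hle : Submodule.span Fq (Set.range fun i => y (e.symm (b, i))) ≤
          Submodule.span Fq (Set.range w) := by
        rw [Submodule.span_le]
        rintro _ ⟨i, rfl⟩
        simp only [y, Matrix.vecMul, dotProduct, Matrix.map_apply]
        refine Submodule.sum_mem _ fun a _ => ?_
        rw [mul_comm, ← Algebra.smul_def]
        exact Submodule.smul_mem _ _ (Submodule.subset_span ⟨a, rfl⟩)
      refine (Submodule.finrank_mono hle).trans ((finrank_range_le_card w).trans ?_)
      simpa using hμ
    · let f : Fin l → ℕ → K := fun b' s' => if b' = b ∧ s' = s then 1 else 0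
      have hm : (B.map (algebraMap Fq K)) *ᵥ gabidulinWord (Fq := Fq) g e f ∈ P :=
        ⟨f, fun b' s' h => if_neg (by omega), rfl⟩
      have h0 := LinearMap.mem_ker.1 (hPL hm)
      rw [hLw, Matrix.dotProduct_mulVec, ← hy, dotProduct, ← e.symm.sum_comp,
        Fintype.sum_prod_type, Finset.sum_eq_single b] at h0
      · rw [← h0]
        refine Finset.sum_congr rfl fun i _ => ?_
        congr 1
        simp only [gabidulinWord, Equiv.apply_symm_apply, f, true_and, ite_mul, one_mul, zero_mul]
        rw [Finset.sum_ite_eq', if_pos (Finset.mem_range.2 (by omega))]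
      · intro b' _ hb'
        refine Finset.sum_eq_zero fun i _ => ?_
        simp [gabidulinWord, f, hb']
      · simp
  have hy0 : y = 0 := by
    funext c
    have := congrFun (hyz (e c).1) (e c).2
    simpa using this
  rw [hLw, Matrix.dotProduct_mulVec, ← hy, hy0, zero_dotProduct]

end GabidulinPowers

section RankWeight

variable {Fq K : Type*} [Field Fq] [Field K] [Algebra Fq K]

theorem rkVec_sub_le {N : ℕ} (u v : Fin N → K) : rkVec Fq (u - v) ≤ rkVec Fq u + rkVec Fq v := by
  unfold rkVec
  have hle : Submodule.span Fq (Set.range (u - v)) ≤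
      Submodule.span Fq (Set.range u) ⊔ Submodule.span Fq (Set.range v) := by
    rw [Submodule.span_le]
    rintro _ ⟨i, rfl⟩
    exact Submodule.sub_mem _
      (Submodule.mem_sup_left (Submodule.subset_span ⟨i, rfl⟩))
      (Submodule.mem_sup_right (Submodule.subset_span ⟨i, rfl⟩))
  have : FiniteDimensional Fq (Submodule.span Fq (Set.range u)) :=
    FiniteDimensional.span_of_finite Fq (Set.finite_range u)
  have : FiniteDimensional Fq (Submodule.span Fq (Set.range v)) :=
    FiniteDimensional.span_of_finite Fq (Set.finite_range v)
  exact (Submodule.finrank_mono hle).trans (Submodule.finrank_add_le_finrank_add_finrank _ _)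

theorem rkMat_zero (a N : ℕ) : rkMat Fq (0 : Matrix (Fin a) (Fin N) K) = 0 := by
  have hbot : Submodule.span Fq
      (Set.range fun j : Fin N => fun i : Fin a => (0 : Matrix (Fin a) (Fin N) K) i j) = ⊥ := by
    rw [Submodule.span_eq_bot]
    rintro _ ⟨j, rfl⟩
    rfl
  unfold rkMat
  rw [hbot, finrank_bot]

theorem rkVec_row_le_rkMat {a N : ℕ} (E : Matrix (Fin a) (Fin N) K) (r : Fin a) :
    rkVec Fq (E r) ≤ rkMat Fq E := by
  unfold rkVec rkMat
  have hmap : Submodule.span Fq (Set.range (E r)) =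
      (Submodule.span Fq (Set.range fun j : Fin N => fun i : Fin a => E i j)).map
        (LinearMap.proj r : (Fin a → K) →ₗ[Fq] K) := by
    rw [Submodule.map_span, ← Set.range_comp]
    rfl
  have : FiniteDimensional Fq
      (Submodule.span Fq (Set.range fun j : Fin N => fun i : Fin a => E i j)) :=
    FiniteDimensional.span_of_finite Fq (Set.finite_range _)
  rw [hmap]
  exact Submodule.finrank_map_le _ _

/-- Multiplying by a matrix over the base field lowers the rank weight of a vector by at most the
nullity of the matrix. -/
theorem rkVec_le_rkVec_mulVec_add {N n : ℕ} (A : Matrix (Fin N) (Fin n) Fq) (v : Fin n → K) :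
    rkVec Fq v ≤ rkVec Fq (A.map (algebraMap Fq K) *ᵥ v) + (n - A.rank) := by
  let Φ : (Fin n → Fq) →ₗ[Fq] K := Fintype.linearCombination Fq v
  have hΦ : ∀ x, Φ x = ∑ i, x i • v i := fun x => Fintype.linearCombination_apply Fq v x
  set W := Submodule.span Fq (Set.range A.row) with hW
  have hmap : W.map Φ = Submodule.span Fq (Set.range (A.map (algebraMap Fq K) *ᵥ v)) := by
    rw [hW, Submodule.map_span, ← Set.range_comp]
    congr 2
    funext a
    rw [Function.comp_apply, hΦ]
    simp [Matrix.mulVec, dotProduct, Algebra.smul_def, Matrix.row]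
  have hrange : LinearMap.range Φ = Submodule.span Fq (Set.range v) :=
    Fintype.range_linearCombination Fq v
  have hker : Module.finrank Fq (LinearMap.ker (Φ.domRestrict W)) ≤
      Module.finrank Fq (LinearMap.ker Φ) := by
    refine LinearMap.finrank_le_finrank_of_injective
      (f := (W.subtype.domRestrict (LinearMap.ker (Φ.domRestrict W))).codRestrict
        (LinearMap.ker Φ) fun x => x.2) ?_
    intro x y hxy
    exact Subtype.ext (Subtype.ext (congrArg (LinearMap.ker Φ).subtype hxy))
  have h1 := LinearMap.finrank_range_add_finrank_ker Φ
  have h2 := LinearMap.finrank_range_add_finrank_ker (Φ.domRestrict W)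
  have hWrank : Module.finrank Fq W = A.rank := (A.rank_eq_finrank_span_row).symm
  have hr : LinearMap.range (Φ.domRestrict W) = W.map Φ := LinearMap.range_domRestrict W Φ
  rw [hr, hmap, hWrank] at h2
  rw [hrange, Module.finrank_fin_fun] at h1
  unfold rkVec
  omega

end RankWeight

section Staircase

variable {l : ℕ} {V M : Type*}

/-- The coefficient positions of the rows in the `j`-th block, above the `k₂` random ones. -/
def blockPositions (l k₂ : ℕ) (B k : ℕ → ℕ) (j : ℕ) : Finset (ℕ × Fin l × ℕ) :=
  Finset.Ico (B j) (B (j + 1)) ×ˢ Finset.univ ×ˢ Finset.Ico k₂ (k j)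

/-- The coefficient positions whose content is repeated in the block `j + 1`. -/
def carriedPositions (l : ℕ) (B k : ℕ → ℕ) (j : ℕ) : Finset (ℕ × Fin l × ℕ) :=
  Finset.range (B (j + 1)) ×ˢ Finset.univ ×ˢ Finset.Ico (k (j + 1)) (k j)

/-- Coefficient arrays of staircase shape: the rows from `B j` on have fewer than `k j + 1`
coefficients, the coefficients in `carriedPositions` are repeated in the next block according to
`e`, and the message `S` is placed according to `e₀`. -/
structure IsStaircase [Zero V] (B k : ℕ → ℕ) (e₀ : M → ℕ × Fin l × ℕ)
    (e : ℕ → ℕ × Fin l × ℕ → ℕ × Fin l × ℕ) (S : M → V) (F : ℕ × Fin l × ℕ → V) : Prop where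
  vanish : ∀ j p, B j ≤ p.1 → k j ≤ p.2.2 → F p = 0
  carry : ∀ j, ∀ p ∈ carriedPositions l B k j, F (e j p) = F p
  message : ∀ x, F (e₀ x) = S x

theorem IsStaircase.sub [AddGroup V] {B k : ℕ → ℕ} {e₀ : M → ℕ × Fin l × ℕ}
    {e : ℕ → ℕ × Fin l × ℕ → ℕ × Fin l × ℕ} {S S' : M → V} {F F' : ℕ × Fin l × ℕ → V}
    (h : IsStaircase B k e₀ e S F) (h' : IsStaircase B k e₀ e S' F') :
    IsStaircase B k e₀ e (S - S') (F - F') where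
  vanish j p hB hk := by simp [h.vanish j p hB hk, h'.vanish j p hB hk]
  carry j p hp := by simp [h.carry j p hp, h'.carry j p hp]
  message x := by simp [h.message x, h'.message x]

/-- A staircase array remains one after changing the first `k₂` coefficients of the rows. -/
theorem IsStaircase.add_random [AddGroup V] {k₂ : ℕ} {B k : ℕ → ℕ} {e₀ : M → ℕ × Fin l × ℕ}
    {e : ℕ → ℕ × Fin l × ℕ → ℕ × Fin l × ℕ} {S : M → V} {F R : ℕ × Fin l × ℕ → V}
    (h : IsStaircase B k e₀ e S F) (hk : ∀ j, k₂ ≤ k j)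
    (he₀ : ∀ x, e₀ x ∈ blockPositions l k₂ B k 0)
    (he : ∀ j, ∀ p ∈ carriedPositions l B k j, e j p ∈ blockPositions l k₂ B k (j + 1))
    (hR : ∀ p, k₂ ≤ p.2.2 → R p = 0) : IsStaircase B k e₀ e S (F + R) where
  vanish j p hB hkj := by simp [h.vanish j p hB hkj, hR p ((hk j).trans hkj)]
  carry j p hp := by
    have h1 := he j p hp
    simp only [blockPositions, Finset.mem_product, Finset.mem_Ico] at h1
    have h2 := hp
    simp only [carriedPositions, Finset.mem_product, Finset.mem_Ico] at h2
    simp [h.carry j p hp, hR _ h1.2.2.1, hR p ((hk (j + 1)).trans h2.2.2.1)]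
  message x := by
    have h1 := he₀ x
    simp only [blockPositions, Finset.mem_product, Finset.mem_Ico] at h1
    simp [h.message x, hR _ h1.2.2.1]

/-- Decoding a staircase array of the zero message from its rows in the first `j + 1` blocks: if
each of these rows vanishes as soon as it has at most `k j` coefficients, they all vanish. -/
theorem IsStaircase.eq_zero [Zero V] {k₂ : ℕ} {B k : ℕ → ℕ} {e₀ : M → ℕ × Fin l × ℕ}
    {e : ℕ → ℕ × Fin l × ℕ → ℕ × Fin l × ℕ} {S : M → V} {F : ℕ × Fin l × ℕ → V}
    (h : IsStaircase B k e₀ e S F) (hB0 : B 0 = 0) (hB : Monotone B)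
    (he₀ : ∀ x, e₀ x ∈ blockPositions l k₂ B k 0)
    (he : ∀ j, ∀ p ∈ carriedPositions l B k j, e j p ∈ blockPositions l k₂ B k (j + 1))
    (j : ℕ)
    (hrow : ∀ r < B (j + 1), (∀ b s, k j ≤ s → F (r, b, s) = 0) → ∀ b s, F (r, b, s) = 0) :
    S = 0 := by
  have key : ∀ N r, B (j + 1) - r ≤ N → r < B (j + 1) → ∀ b s, F (r, b, s) = 0 := by
    intro N
    induction N with
    | zero => intro r h1 h2; omega
    | succ N ih =>
      intro r hN hr
      refine hrow r hr fun b s hs => ?_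
      classical
      have hex : ∃ i, k i ≤ s := ⟨j, hs⟩
      have hile : Nat.find hex ≤ j := Nat.find_min' hex hs
      have hki := Nat.find_spec hex
      rcases hi : Nat.find hex with _ | i
      · rw [hi] at hki
        exact h.vanish 0 _ (by simp [hB0]) hki
      · rw [hi] at hki hile
        have hlt : s < k i := not_le.1 (Nat.find_min hex (by omega))
        by_cases hri : B (i + 1) ≤ r
        · exact h.vanish (i + 1) _ hri hki
        · have hp : ((r, b, s) : ℕ × Fin l × ℕ) ∈ carriedPositions l B k i := by
            simp only [carriedPositions, Finset.mem_product, Finset.mem_Ico, Finset.mem_range,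
              Finset.mem_univ, true_and]
            exact ⟨by omega, hki, hlt⟩
          have hq := he i _ hp
          simp only [blockPositions, Finset.mem_product, Finset.mem_Ico] at hq
          have hmono : B (i + 1 + 1) ≤ B (j + 1) := hB (by omega)
          rw [← h.carry i _ hp]
          exact ih _ (by omega) (by omega) _ _
  funext x
  have hx := he₀ x
  simp only [blockPositions, Finset.mem_product, Finset.mem_Ico] at hx
  have hmono : B (0 + 1) ≤ B (j + 1) := hB (by omega)
  rw [← h.message x, Pi.zero_apply]
  exact key _ _ le_rfl (by omega) _ _

/-- The array filled row by row: the content of `src p` is copied to the position `p` if it lies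
in an earlier row, and the other positions are filled by `T`. -/
def fillArray [Zero V] (src : ℕ × Fin l × ℕ → Option (ℕ × Fin l × ℕ)) (T : ℕ × Fin l × ℕ → V)
    (p : ℕ × Fin l × ℕ) : V :=
  match src p with
  | some p' => if p'.1 < p.1 then fillArray src T p' else 0
  | none => T p
termination_by p.1

theorem exists_isStaircase [Zero V] {k₂ : ℕ} {B k : ℕ → ℕ} {e₀ : M → ℕ × Fin l × ℕ}
    {e : ℕ → ℕ × Fin l × ℕ → ℕ × Fin l × ℕ} (hB : Monotone B) (hk : Antitone k)
    (he₀ : ∀ x, e₀ x ∈ blockPositions l k₂ B k 0) (he₀i : Function.Injective e₀)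
    (he : ∀ j, ∀ p ∈ carriedPositions l B k j, e j p ∈ blockPositions l k₂ B k (j + 1))
    (hei : ∀ j, Set.InjOn (e j) (carriedPositions l B k j)) (S : M → V) :
    ∃ F, IsStaircase B k e₀ e S F := by
  classical
  have hdisj : ∀ {i j p}, p ∈ blockPositions l k₂ B k i → p ∈ blockPositions l k₂ B k j →
      i ≤ j := by
    intro i j p hi hj
    simp only [blockPositions, Finset.mem_product, Finset.mem_Ico] at hi hj
    by_contra hij
    have := hB (show j + 1 ≤ i by omega)
    omega
  let src : ℕ × Fin l × ℕ → Option (ℕ × Fin l × ℕ) := fun p =>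
    if h : ∃ x j, x ∈ carriedPositions l B k j ∧ e j x = p then some h.choose else none
  have hsrc : ∀ j, ∀ x ∈ carriedPositions l B k j, src (e j x) = some x := by
    intro j x hx
    have h : ∃ x' j', x' ∈ carriedPositions l B k j' ∧ e j' x' = e j x := ⟨x, j, hx, rfl⟩
    simp only [src]
    rw [dif_pos h]
    obtain ⟨j', hx', hj'⟩ := h.choose_spec
    have h1 := he j x hx
    have h2 := he j' _ hx'
    rw [hj'] at h2
    obtain rfl : j' = j := by have := hdisj h1 h2; have := hdisj h2 h1; omega
    rw [hei j' hx' hx hj']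
  have hnone : ∀ p, (∀ j, p ∉ blockPositions l k₂ B k (j + 1)) → src p = none := by
    intro p hp
    simp only [src]
    rw [dif_neg]
    rintro ⟨x, j, hx, rfl⟩
    exact hp j (he j x hx)
  refine ⟨fillArray src (Function.extend e₀ S 0), ?_, ?_, ?_⟩
  · intro j p hBj hkj
    have hp : ∀ i, p ∉ blockPositions l k₂ B k i := by
      intro i hi
      simp only [blockPositions, Finset.mem_product, Finset.mem_Ico] at hi
      by_cases hij : j ≤ i
      · have := hk hij
        omega
      · have := hB (show i + 1 ≤ j by omega)
        omega
    rw [fillArray, hnone p fun j => hp _]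
    simp only
    rw [Function.extend_apply', Pi.zero_apply]
    rintro ⟨x, rfl⟩
    exact hp 0 (he₀ x)
  · intro j p hp
    rw [fillArray, hsrc j p hp]
    have h1 := he j p hp
    simp only [blockPositions, carriedPositions, Finset.mem_product, Finset.mem_Ico,
      Finset.mem_range] at h1 hp
    simp only
    rw [if_pos (by omega)]
  · intro x
    rw [fillArray, hnone]
    · exact he₀i.extend_apply S 0 x
    · intro j hj
      have := hdisj hj (he₀ x)
      omega

theorem exists_injOn_of_card_eq {P : Type*} {s t : Finset P} (h : s.card = t.card) :
    ∃ f : P → P, (∀ x ∈ s, f x ∈ t) ∧ Set.InjOn f s := by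
  classical
  let e := Finset.equivOfCardEq h
  refine ⟨fun x => if hx : x ∈ s then e ⟨x, hx⟩ else x, fun x hx => ?_, fun x hx y hy hxy => ?_⟩
  · simp [hx]
  · rw [Finset.mem_coe] at hx hy
    simp only [hx, hy, dif_pos] at hxy
    exact congrArg Subtype.val (e.injective (Subtype.ext hxy))

theorem exists_staircase_placement [Fintype M] (l k₂ c : ℕ) {B k : ℕ → ℕ} (hB0 : B 0 = 0)
    (hk₂ : ∀ j, k₂ ≤ k j) (hBk : ∀ j, B (j + 1) * (k j - k₂) = c)
    (hM : Fintype.card M = c * l) :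
    ∃ (e₀ : M → ℕ × Fin l × ℕ) (e : ℕ → ℕ × Fin l × ℕ → ℕ × Fin l × ℕ),
      (∀ x, e₀ x ∈ blockPositions l k₂ B k 0) ∧ Function.Injective e₀ ∧
      (∀ j, ∀ p ∈ carriedPositions l B k j, e j p ∈ blockPositions l k₂ B k (j + 1)) ∧
      ∀ j, Set.InjOn (e j) (carriedPositions l B k j) := by
  have hcard : ∀ j, (carriedPositions l B k j).card = (blockPositions l k₂ B k (j + 1)).card := by
    intro j
    simp only [carriedPositions, blockPositions, Finset.card_product, Finset.card_range,
      Nat.card_Ico, Finset.card_univ, Fintype.card_fin]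
    have h1 : k j - k (j + 1) = (k j - k₂) - (k (j + 1) - k₂) := by
      have := hk₂ (j + 1)
      omega
    rw [h1, mul_left_comm, mul_left_comm (B (j + 1 + 1) - B (j + 1)), Nat.mul_sub, Nat.sub_mul,
      hBk j, hBk (j + 1)]
  choose e he hei using fun j => exists_injOn_of_card_eq (hcard j)
  have hcard0 : Fintype.card M = Fintype.card (blockPositions l k₂ B k 0) := by
    simp only [blockPositions, Fintype.card_coe, Finset.card_product, Nat.card_Ico,
      Finset.card_univ, Fintype.card_fin, hB0, Nat.sub_zero]
    rw [hM, mul_left_comm, hBk 0, mul_comm]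
  let e₀ := Fintype.equivOfCardEq hcard0
  exact ⟨fun x => e₀ x, e, fun x => (e₀ x).2, Subtype.val_injective.comp e₀.injective, he, hei⟩

end Staircase

section Scheme

variable {Fq K : Type*} [Field Fq] [Field K] [Algebra Fq K]

theorem exists_decoder {I O Msg : Type*} [Nonempty Msg] (obs : I → O) (msg : I → Msg)
    (h : ∀ i i', obs i = obs i' → msg i = msg i') : ∃ D : O → Msg, ∀ i, D (obs i) = msg i := by
  obtain ⟨D, hD⟩ := (Function.factorsThrough_iff msg).1 fun i i' => h i i'
  exact ⟨D, fun i => (congrFun hD i).symm⟩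

theorem matrix_add_row {a N : ℕ} (X Y : Matrix (Fin a) (Fin N) K) (r : Fin a) :
    (X + Y) r = X r + Y r := rfl

theorem mul_transpose_row {a N n : ℕ} (X : Matrix (Fin a) (Fin n) K)
    (A : Matrix (Fin N) (Fin n) K) (r : Fin a) : (X * Aᵀ) r = A *ᵥ X r := by
  funext i
  simp [Matrix.mul_apply, Matrix.mulVec, dotProduct, mul_comm]

/-- The coset coding scheme whose rows are words with coefficients `F₀ S`, randomized in the first
`k₂` coefficients. -/
def randomizedScheme [Fintype Fq] {M : Type*} {l m n : ℕ} (α k₂ : ℕ) (g : Fin m → K)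
    (e : Fin n ≃ Fin l × Fin m) (F₀ : M → ℕ × Fin l × ℕ → K) (S : M) :
    Set (Matrix (Fin α) (Fin n) K) :=
  {X | ∃ R : ℕ × Fin l × ℕ → K, (∀ p, k₂ ≤ p.2.2 → R p = 0) ∧
    ∀ r : Fin α, X r = gabidulinWord (Fq := Fq) g e fun b s => (F₀ S + R) (r, b, s)}

theorem univSecure_randomizedScheme [Fintype Fq] [Fintype K] {l m n α ℓ k₂ μ : ℕ}
    {g : Fin m → K} (hg : LinearIndependent Fq g) (e : Fin n ≃ Fin l × Fin m) (hk₂ : k₂ ≤ m)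
    (hμ : μ ≤ k₂) (F₀ : Matrix (Fin α) (Fin ℓ) K → ℕ × Fin l × ℕ → K) :
    UnivSecure Fq μ (randomizedScheme (Fq := Fq) α k₂ g e F₀) := by
  intro B S₁ S₂ W
  choose f hf hfB using fun r : Fin α => exists_gabidulinWord_mulVec_eq hg e hμ hk₂ B
    (gabidulinWord (Fq := Fq) g e fun b s => (F₀ S₁ - F₀ S₂) (r, b, s))
  let R₀ : ℕ × Fin l × ℕ → K := fun p => if h : p.1 < α then f ⟨p.1, h⟩ p.2.1 p.2.2 else 0
  have hR₀ : ∀ p, k₂ ≤ p.2.2 → R₀ p = 0 := by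
    intro p hp
    simp only [R₀]
    split_ifs with h
    · exact hf _ _ _ hp
    · rfl
  let δ : Matrix (Fin α) (Fin n) K := fun r =>
    gabidulinWord (Fq := Fq) g e fun b s => (F₀ S₂ - F₀ S₁ + R₀) (r, b, s)
  have hδ : δ * (B.map (algebraMap Fq K))ᵀ = 0 := by
    refine funext fun r => ?_
    have h1 : δ r = gabidulinWord (Fq := Fq) g e (f r) -
        gabidulinWord (Fq := Fq) g e fun b s => (F₀ S₁ - F₀ S₂) (r, b, s) := by
      rw [← gabidulinWord_sub]
      simp only [δ]
      congr 1
      funext b s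
      simp [R₀]
      ring
    rw [mul_transpose_row, h1, Matrix.mulVec_sub, hfB, sub_self]
    rfl
  have hmem : ∀ X, X ∈ randomizedScheme (Fq := Fq) α k₂ g e F₀ S₁ ↔
      X + δ ∈ randomizedScheme (Fq := Fq) α k₂ g e F₀ S₂ := by
    intro X
    constructor
    · rintro ⟨R, hR, hX⟩
      refine ⟨R + R₀, fun p hp => by simp [hR p hp, hR₀ p hp], fun r => ?_⟩
      rw [matrix_add_row, hX r]
      simp only [δ]
      rw [← gabidulinWord_add]
      congr 1
      funext b s
      simp only [Pi.add_apply, Pi.sub_apply]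
      ring
    · rintro ⟨R, hR, hX⟩
      refine ⟨R - R₀, fun p hp => by simp [hR p hp, hR₀ p hp], fun r => ?_⟩
      have h1 := hX r
      rw [matrix_add_row, ← eq_sub_iff_add_eq] at h1
      rw [h1]
      simp only [δ]
      rw [← gabidulinWord_sub]
      congr 1
      funext b s
      simp only [Pi.add_apply, Pi.sub_apply]
      ring
  have hcard : ∀ P Q : Set (Matrix (Fin α) (Fin n) K), (∀ X, X ∈ P ↔ X + δ ∈ Q) →
      P.ncard = Q.ncard := by
    intro P Q hPQ
    rw [← Set.ncard_image_of_injective P (add_left_injective δ)]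
    congr 1
    ext Y
    constructor
    · rintro ⟨X, hX, rfl⟩
      exact (hPQ X).1 hX
    · intro hY
      exact ⟨Y - δ, (hPQ _).2 (by simpa using hY), sub_add_cancel _ _⟩
  congr 1
  · refine hcard _ _ fun X => ?_
    simp only [Set.mem_ofPred_eq, hmem X, Matrix.add_mul, hδ, add_zero]
  · exact (hcard _ _ hmem).symm

/-- The staircase coset coding scheme: it is secure against `k₂` observations, and the message is
determined by the observations of the rows in the first `j + 1` blocks whenever the
`k j`-dimensional Gabidulin code corrects the given numbers of errors and erasures. -/
theorem exists_staircase_scheme [Fintype Fq] [Fintype K] {l m n α ℓ k₂ c : ℕ} {B k : ℕ → ℕ}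
    (hfin : Module.finrank Fq K = m) (e : Fin n ≃ Fin l × Fin m) (hB0 : B 0 = 0)
    (hB : Monotone B) (hk : Antitone k) (hk₂ : ∀ j, k₂ ≤ k j) (hk₂m : k₂ ≤ m)
    (hBk : ∀ j, B (j + 1) * (k j - k₂) = c) (hBα : ∀ j, B j ≤ α) (hcard : α * ℓ = c * l) :
    ∃ CS : Matrix (Fin α) (Fin ℓ) K → Set (Matrix (Fin α) (Fin n) K),
      (∀ S, (CS S).Nonempty) ∧ (∀ μ ≤ k₂, UnivSecure Fq μ CS) ∧
      ∀ (j t ρ N : ℕ) (A : Matrix (Fin N) (Fin n) Fq), n - ρ ≤ A.rank → 2 * t + ρ + k j ≤ m →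
        ∀ (S S' : Matrix (Fin α) (Fin ℓ) K) (X X' : Matrix (Fin α) (Fin n) K),
          X ∈ CS S → X' ∈ CS S' →
          ∀ E E' : Matrix (Fin α) (Fin N) K, rkMat Fq E ≤ t → rkMat Fq E' ≤ t →
            (∀ r : Fin α, (r : ℕ) < B (j + 1) →
              (X * (A.map (algebraMap Fq K))ᵀ + E) r =
                (X' * (A.map (algebraMap Fq K))ᵀ + E') r) → S = S' := by
  obtain ⟨e₀, σ, he₀, he₀i, hσ, hσi⟩ := exists_staircase_placement (M := Fin α × Fin ℓ) l k₂ c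
    hB0 hk₂ hBk (by simpa using hcard)
  choose F₀ hF₀ using fun S : Matrix (Fin α) (Fin ℓ) K =>
    exists_isStaircase hB hk he₀ he₀i hσ hσi fun x => S x.1 x.2
  let b : Module.Basis (Fin m) Fq K := Module.finBasisOfFinrankEq Fq K hfin
  refine ⟨randomizedScheme (Fq := Fq) α k₂ b e F₀, fun S => ?_, fun μ hμ =>
    univSecure_randomizedScheme b.linearIndependent e hk₂m hμ F₀, ?_⟩
  · exact ⟨fun r => gabidulinWord (Fq := Fq) b e fun b s => (F₀ S + 0) (r, b, s), 0,
      fun _ _ => rfl, fun _ => rfl⟩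
  · rintro j t ρ N A hA hle S S' X X' ⟨R, hR, hX⟩ ⟨R', hR', hX'⟩ E E' hE hE' hobs
    have hst := ((hF₀ S).add_random hk₂ he₀ hσ hR).sub ((hF₀ S').add_random hk₂ he₀ hσ hR')
    have h0 := hst.eq_zero hB0 hB he₀ hσ j fun r hr hvan => by
      have hrα : r < α := hr.trans_le (hBα _)
      have hword : X ⟨r, hrα⟩ - X' ⟨r, hrα⟩ =
          gabidulinWord (Fq := Fq) b e fun b s => (F₀ S + R - (F₀ S' + R')) (r, b, s) := by
        rw [hX, hX', ← gabidulinWord_sub]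
        rfl
      have hdiff : A.map (algebraMap Fq K) *ᵥ (X ⟨r, hrα⟩ - X' ⟨r, hrα⟩) =
          E' ⟨r, hrα⟩ - E ⟨r, hrα⟩ := by
        have h1 := hobs ⟨r, hrα⟩ hr
        rw [matrix_add_row, matrix_add_row, mul_transpose_row,
          mul_transpose_row] at h1
        rw [Matrix.mulVec_sub, sub_eq_sub_iff_add_eq_add, h1, add_comm]
      have hrk : rkVec Fq (X ⟨r, hrα⟩ - X' ⟨r, hrα⟩) ≤ 2 * t + ρ := by
        have h1 := rkVec_le_rkVec_mulVec_add A (X ⟨r, hrα⟩ - X' ⟨r, hrα⟩)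
        rw [hdiff] at h1
        have h2 := rkVec_sub_le (Fq := Fq) (E' ⟨r, hrα⟩) (E ⟨r, hrα⟩)
        have h3 := rkVec_row_le_rkMat (Fq := Fq) E ⟨r, hrα⟩
        have h4 := rkVec_row_le_rkMat (Fq := Fq) E' ⟨r, hrα⟩
        omega
      have hz := eq_zero_of_rkVec_gabidulinWord hfin b.span_eq e _ hvan
        (by rw [← hword]; omega)
      exact fun b s => congrFun (congrFun hz b) s
    ext i x
    exact sub_eq_zero.1 (congrFun h0 (i, x))

end Scheme

/-- coset coding schemes from cartesian products of Gabidulin codes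
(`n = l·m`). Here `d j` is `d_{j+1}` for `j : Fin h`. -/
theorem stmt12 {Fq Fqm : Type*} [Field Fq] [Field Fqm] [Algebra Fq Fqm]
    [Fintype Fq] [Fintype Fqm]
    (q m l n ℓ k₁ k₂ t₀ ρ₀ h α : ℕ) (hq : IsPrimePow q)
    (hm : 0 < m) (hl : 0 < l) (hn : n = l * m) (hh : 1 ≤ h)
    (hcq : Fintype.card Fq = q) (hcqm : Fintype.card Fqm = q ^ m)
    (hk : k₂ < k₁) (hk₁ : k₁ ≤ m)
    (ht₀ρ₀ : 2 * t₀ + ρ₀ = m - k₁)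
    (hℓ : ℓ = l * (k₁ - k₂))
    (d : Fin h → ℕ) (hd_anti : StrictAnti d) (hd_le : d ⟨0, by omega⟩ ≤ n)
    (hd_last : d ⟨h - 1, by omega⟩ = n - ρ₀)
    (hα : α = Finset.univ.lcm fun j : Fin h => l * (d j - 2 * t₀ - k₂) - (l - 1) * n) :
    ∃ CS : Matrix (Fin α) (Fin ℓ) Fqm → Set (Matrix (Fin α) (Fin n) Fqm),
      (∀ S, (CS S).Nonempty) ∧
      (∀ S T, S ≠ T → Disjoint (CS S) (CS T)) ∧
      (∀ t ρ : ℕ, 2 * t + ρ ≤ m - k₁ → UnivCorrecting Fq t ρ CS) ∧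
      (∀ μ : ℕ, μ ≤ k₂ → UnivSecure Fq μ CS) ∧
      (∀ j : Fin h, ∀ A : Matrix (Fin (d j)) (Fin n) Fq, A.rank = d j →
        ∃ β : ℕ, β * (l * (d j - 2 * t₀ - k₂) - (l - 1) * n) = ℓ * α ∧
          ∃ EA : Fin (d j) → (Fin α → Fqm) → (Fin β → Fqm),
            PreprocCorrecting Fq t₀ A (β := fun _ => β) EA CS ∧
            ((d j : ℚ) * β / α - ℓ
              = (ℓ : ℚ) * ((l : ℚ) * (2 * (t₀ : ℚ) + (k₂ : ℚ))
                    + ((l : ℚ) - 1) * ((n : ℚ) - (d j : ℚ)))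
                / ((l : ℚ) * ((d j : ℚ) - 2 * (t₀ : ℚ) - (k₂ : ℚ))
                    - ((l : ℚ) - 1) * (n : ℚ)))) := by
  have hmn : m ≤ n := hn ▸ Nat.le_mul_of_pos_left m hl
  have hfin : Module.finrank Fq Fqm = m := by
    have h1 : Fintype.card Fqm = Fintype.card Fq ^ Module.finrank Fq Fqm :=
      Module.card_eq_pow_finrank
    rw [hcqm, hcq] at h1
    exact (Nat.pow_right_injective hq.two_le h1).symm
  let e : Fin n ≃ Fin l × Fin m := (finCongr hn).trans finProdFinEquiv.symm
  let d' : ℕ → ℕ := fun j => d ⟨min j (h - 1), by omega⟩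
  have hd'_anti : Antitone d' := fun i j hij =>
    hd_anti.antitone (Fin.mk_le_mk.2 (min_le_min_right _ hij))
  have hd'_last : d' (h - 1) = n - ρ₀ := by simp [d', hd_last]
  have hd'_of_lt : ∀ j : Fin h, d' j = d j := by
    intro j
    simp only [d']
    congr 1
    exact Fin.ext (min_eq_left (by omega))
  have hd'_le : ∀ j, d' j ≤ n := fun j =>
    (hd_anti.antitone (Fin.mk_le_mk.2 (Nat.zero_le _))).trans hd_le
  have hd'_ge : ∀ j, n - ρ₀ ≤ d' j := by
    intro j
    rw [← hd_last]
    exact hd_anti.antitone (Fin.mk_le_mk.2 (min_le_right _ _))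
  let k : ℕ → ℕ := fun j => m - 2 * t₀ - (n - d' j)
  have hk_def : ∀ j, k j = m - 2 * t₀ - (n - d' j) := fun _ => rfl
  have hk_ge : ∀ j, k₁ ≤ k j := by
    intro j
    have := hd'_ge j
    rw [hk_def]
    omega
  have hk_anti : Antitone k := by
    intro i j hij
    have := hd'_anti hij
    rw [hk_def, hk_def]
    omega
  have hk_last : k (h - 1) = k₁ := by
    rw [hk_def, hd'_last]
    omega
  have hκ : ∀ j, l * (d' j - 2 * t₀ - k₂) - (l - 1) * n = (k j - k₂) * l := by
    intro j
    have h1 := hd'_ge j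
    have h2 := hd'_le j
    have h3 := hk_ge j
    obtain ⟨l', rfl⟩ : ∃ l', l = l' + 1 := ⟨l - 1, by omega⟩
    have h4 : n = l' * m + m := by rw [hn]; ring
    have h5 : d' j - 2 * t₀ - k₂ = l' * m + (k j - k₂) := by
      have := hk_def j
      omega
    rw [h5, Nat.add_sub_cancel, hn, show (l' + 1) * (l' * m + (k j - k₂)) =
      (k j - k₂) * (l' + 1) + l' * ((l' + 1) * m) by ring, Nat.add_sub_cancel]
  have hdvd_fin : ∀ j : Fin h, (k j - k₂) * l ∣ α := by
    intro j
    rw [← hκ, hd'_of_lt, hα]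
    exact Finset.dvd_lcm (Finset.mem_univ j)
  have hdvd : ∀ j, (k j - k₂) ∣ α := by
    intro j
    have h1 := hdvd_fin ⟨min j (h - 1), by omega⟩
    have h2 : k (min j (h - 1)) = k j := by simp [hk_def, d']
    simp only [h2] at h1
    exact (Dvd.intro _ rfl).trans h1
  have hα0 : α ≠ 0 := by
    rw [hα, Ne, Finset.lcm_eq_zero_iff]
    rintro ⟨j, -, hj⟩
    rw [← hd'_of_lt, hκ] at hj
    have := hk_ge j
    rcases Nat.mul_eq_zero.1 hj with h1 | h1 <;> omega
  let B : ℕ → ℕ := fun j => Nat.casesOn j 0 fun j => α * (k₁ - k₂) / (k j - k₂)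
  have hB_succ : ∀ j, B (j + 1) = α * (k₁ - k₂) / (k j - k₂) := fun _ => rfl
  have hB_mono : Monotone B := by
    refine monotone_nat_of_le_succ fun j => ?_
    cases j with
    | zero => exact Nat.zero_le _
    | succ j =>
      rw [hB_succ, hB_succ]
      have h1 := hk_ge (j + 1)
      have h2 := hk_anti (show j ≤ j + 1 by omega)
      exact Nat.div_le_div_left (by omega) (by omega)
  have hBk : ∀ j, B (j + 1) * (k j - k₂) = α * (k₁ - k₂) := fun j =>
    Nat.div_mul_cancel ((hdvd j).mul_right _)
  have hBα : ∀ j, B j ≤ α := by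
    intro j
    cases j with
    | zero => exact Nat.zero_le _
    | succ j =>
      have := hk_ge j
      refine Nat.div_le_of_le_mul ?_
      rw [mul_comm]
      exact Nat.mul_le_mul_right _ (by omega)
  obtain ⟨CS, hne, hsec, hdec⟩ := exists_staircase_scheme (ℓ := ℓ) hfin e (k₂ := k₂)
    (c := α * (k₁ - k₂)) rfl hB_mono hk_anti (fun j => hk.le.trans (hk_ge j)) (by omega) hBk hBα
    (by rw [hℓ]; ring)
  refine ⟨CS, hne, ?_, ?_, hsec, ?_⟩
  · intro S T hST
    rw [Set.disjoint_left]
    intro X hS hT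
    exact hST (hdec (h - 1) 0 0 n 1 (by simp) (by omega) S T X X hS hT 0 0
      (rkMat_zero _ _).le (rkMat_zero _ _).le fun r _ => rfl)
  · intro t ρ htρ N _ A hA
    obtain ⟨D, hD⟩ := exists_decoder
      (I := {p : Matrix (Fin α) (Fin ℓ) Fqm × Matrix (Fin α) (Fin n) Fqm ×
        Matrix (Fin α) (Fin N) Fqm // p.2.1 ∈ CS p.1 ∧ rkMat Fq p.2.2 ≤ t})
      (fun p => p.1.2.1 * (A.map (algebraMap Fq Fqm))ᵀ + p.1.2.2) (fun p => p.1.1) (by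
        rintro ⟨⟨S, X, E⟩, hX, hE⟩ ⟨⟨S', X', E'⟩, hX', hE'⟩ hobs
        exact hdec (h - 1) t ρ N A hA (by omega) S S' X X' hX hX' E E' hE hE'
          fun r _ => congrFun hobs r)
    exact ⟨D, fun S X E hX hE => hD ⟨(S, X, E), hX, hE⟩⟩
  · intro j A hA
    have hβ : B (j + 1) * ((k j - k₂) * l) = ℓ * α := by
      rw [← mul_assoc, hBk, hℓ]
      ring
    refine ⟨B (j + 1), by rw [← hd'_of_lt, hκ, hβ], fun _ x i => x (Fin.castLE (hBα (j + 1)) i), ?_, ?_⟩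
    · obtain ⟨D, hD⟩ := exists_decoder
        (I := {p : Matrix (Fin α) (Fin ℓ) Fqm × Matrix (Fin α) (Fin n) Fqm ×
          Matrix (Fin α) (Fin (d j)) Fqm // p.2.1 ∈ CS p.1 ∧ rkMat Fq p.2.2 ≤ t₀})
        (fun p (i : Fin (d j)) (r : Fin (B (j + 1))) =>
          (p.1.2.1 * (A.map (algebraMap Fq Fqm))ᵀ) (Fin.castLE (hBα (j + 1)) r) i +
            p.1.2.2 (Fin.castLE (hBα (j + 1)) r) i) (fun p => p.1.1) (by
          rintro ⟨⟨S, X, E⟩, hX, hE⟩ ⟨⟨S', X', E'⟩, hX', hE'⟩ hobs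
          have h1 := hk_ge j
          have h2 := hk_def j
          rw [hd'_of_lt] at h2
          refine hdec j t₀ (n - d j) _ A (by omega) (by omega) S S' X X' hX hX' E E' hE hE'
            fun r hr => ?_
          funext i
          exact congrFun (congrFun hobs i) ⟨r, hr⟩)
      exact ⟨D, fun S X E hX hE => hD ⟨(S, X, E), hX, hE⟩⟩
    · have h1 := hk_ge j
      have h2 := hk_def j
      have h3 := hd'_le j
      rw [hd'_of_lt] at h2 h3
      have hkq : (k j : ℚ) = m - 2 * t₀ - (n - d j) := by
        have : k j + 2 * t₀ + n = m + d j := by omega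
        have := congrArg (Nat.cast : ℕ → ℚ) this
        push_cast at this
        linarith
      have hden : (l : ℚ) * ((d j : ℚ) - 2 * (t₀ : ℚ) - (k₂ : ℚ)) - ((l : ℚ) - 1) * (n : ℚ) =
          (k j - k₂) * l := by
        rw [hkq, hn]
        push_cast
        ring
      have hβq : (B (j + 1) : ℚ) * ((k j - k₂) * l) = ℓ * α := by
        have := congrArg (Nat.cast : ℕ → ℚ) hβ
        push_cast [Nat.cast_sub (show k₂ ≤ k j by omega)] at this
        exact this
      have hα' : (α : ℚ) ≠ 0 := Nat.cast_ne_zero.2 hα0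
      have hl' : (l : ℚ) ≠ 0 := Nat.cast_ne_zero.2 hl.ne'
      have hκ' : (k j : ℚ) - k₂ ≠ 0 := by
        rw [sub_ne_zero]
        exact_mod_cast (show k j ≠ k₂ by omega)
      have hprod : ((k j : ℚ) - k₂) * l ≠ 0 := mul_ne_zero hκ' hl'
      have hβdiv : (B (j + 1) : ℚ) / α = ℓ / ((k j - k₂) * l) := by
        rw [div_eq_div_iff hα' hprod, hβq]
      rw [hden, mul_div_assoc, hβdiv, eq_div_iff hprod, sub_mul, mul_assoc,
        div_mul_cancel₀ _ hprod, ← hden]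
      ring
end

section
/- Let q be a prime power, M, n, ℓ ≥ 1 and t, ρ ≥ 0 integers with 2t + ρ ≤ n. Let (C_S) be a coset coding scheme with message set F_q^{M×ℓ} and codeword set F_q^{M×n}. If the scheme is crisscross t-error and ρ-erasure-correcting, then it is crisscross 0-error and (ρ + 2t)-erasure-correcting. -/
open Matrix

/-- The crisscross weight of a matrix: the minimum size `#X + #Y` of a cover `(X, Y)`
by rows `X` and columns `Y` of all nonzero entries. -/
noncomputable def wtc {K : Type*} [Zero K] {M N : ℕ} (E : Matrix (Fin M) (Fin N) K) : ℕ :=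
  sInf {k | ∃ (X : Finset (Fin M)) (Y : Finset (Fin N)),
    (∀ i j, E i j ≠ 0 → i ∈ X ∨ j ∈ Y) ∧ X.card + Y.card = k}

/-- `colSel I h C = C P_Iᵀ`: the submatrix of the columns of `C` indexed by `I`
(in increasing order). -/
def colSel {K : Type*} {M n d : ℕ} (I : Finset (Fin n)) (h : I.card = d)
    (C : Matrix (Fin M) (Fin n) K) : Matrix (Fin M) (Fin d) K :=
  C.submatrix id (fun j => (I.orderIsoOfFin h j : Fin n))

/-- A coset coding scheme is crisscross `t`-error and `ρ`-erasure-correcting. -/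
def CrissCorrecting {K : Type*} [Field K] {M n ℓ : ℕ} (t ρ : ℕ)
    (CS : Matrix (Fin M) (Fin ℓ) K → Set (Matrix (Fin M) (Fin n) K)) : Prop :=
  ∀ (I : Finset (Fin n)) (h : I.card = n - ρ),
    ∃ D : Matrix (Fin M) (Fin (n - ρ)) K → Matrix (Fin M) (Fin ℓ) K,
      ∀ S C E, C ∈ CS S → wtc E ≤ t → D (colSel I h C + E) = S

/-- A coset coding scheme is secure under `μ` column-observations. -/
def ColSecure {K : Type*} [Field K] {M n ℓ : ℕ} (μ : ℕ)
    (CS : Matrix (Fin M) (Fin ℓ) K → Set (Matrix (Fin M) (Fin n) K)) : Prop :=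
  ∀ (J : Finset (Fin n)) (h : J.card = μ) (S₁ S₂ : Matrix (Fin M) (Fin ℓ) K)
    (W : Matrix (Fin M) (Fin μ) K),
    ({X ∈ CS S₁ | colSel J h X = W}).ncard * (CS S₂).ncard
      = ({X ∈ CS S₂ | colSel J h X = W}).ncard * (CS S₁).ncard

/-- Preprocessing functions `EI i` (applied to the columns of `C` indexed by `I`, plus
errors) are `t`-crisscross-error-correcting with respect to the coset coding scheme. -/
def CrissPreproc {K : Type*} [Field K] {M n ℓ d : ℕ} (t : ℕ)
    (I : Finset (Fin n)) (hI : I.card = d) {b : Fin d → ℕ}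
    (EI : ∀ i : Fin d, (Fin M → K) → (Fin (b i) → K))
    (CS : Matrix (Fin M) (Fin ℓ) K → Set (Matrix (Fin M) (Fin n) K)) : Prop :=
  ∃ D : (∀ i : Fin d, Fin (b i) → K) → Matrix (Fin M) (Fin ℓ) K,
    ∀ S C E, C ∈ CS S → wtc E ≤ t →
      D (fun i => EI i (fun r => C r (I.orderIsoOfFin hI i : Fin n) + E r i)) = S

theorem eq_zero_of_wtc_le_zero {K : Type*} [Zero K] {M N : ℕ} {E : Matrix (Fin M) (Fin N) K}
    (h : wtc E ≤ 0) : E = 0 := by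
  have hmem : wtc E ∈ {k | ∃ (X : Finset (Fin M)) (Y : Finset (Fin N)),
      (∀ i j, E i j ≠ 0 → i ∈ X ∨ j ∈ Y) ∧ X.card + Y.card = k} :=
    Nat.sInf_mem ⟨_, Finset.univ, Finset.univ, fun i _ _ => Or.inl (Finset.mem_univ i), rfl⟩
  obtain ⟨X, Y, hXY, hc⟩ := hmem
  have hX : X = ∅ := Finset.card_eq_zero.mp (by omega)
  have hY : Y = ∅ := Finset.card_eq_zero.mp (by omega)
  subst hX hY
  ext i j
  by_contra hij
  simpa using hXY i j hij

theorem wtc_le_card_of_columns {K : Type*} [Zero K] {M N : ℕ} {E : Matrix (Fin M) (Fin N) K}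
    (Y : Finset (Fin N)) (h : ∀ i j, E i j ≠ 0 → j ∈ Y) : wtc E ≤ Y.card :=
  Nat.sInf_le ⟨∅, Y, fun i j hij => Or.inr (h i j hij), by simp⟩

/-- Restricting to the columns in `L` a matrix supported on the columns in `J` gives
crisscross weight at most `#J`. -/
theorem wtc_colSel_le {K : Type*} [Zero K] {M n d : ℕ} (L : Finset (Fin n)) (h : L.card = d)
    (J : Finset (Fin n)) {A : Matrix (Fin M) (Fin n) K} (hA : ∀ i j, A i j ≠ 0 → j ∈ J) :
    wtc (colSel L h A) ≤ J.card := by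
  refine (wtc_le_card_of_columns
    (Finset.univ.filter fun j => (L.orderIsoOfFin h j : Fin n) ∈ J) fun i j hij => ?_).trans ?_
  · exact Finset.mem_filter.mpr ⟨Finset.mem_univ j, hA i _ hij⟩
  · refine Finset.card_le_card_of_injOn (fun j => (L.orderIsoOfFin h j : Fin n))
      (fun j hj => (Finset.mem_filter.mp hj).2) fun a _ b _ hab => ?_
    exact (L.orderIsoOfFin h).injective (Subtype.ext hab)

theorem eq_of_colSel_eq {K : Type*} {M n d : ℕ} {I : Finset (Fin n)} {h : I.card = d}
    {C C' : Matrix (Fin M) (Fin n) K} (hC : colSel I h C = colSel I h C')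
    (i : Fin M) {j : Fin n} (hj : j ∈ I) : C i j = C' i j := by
  have hij := congrFun (congrFun hC i) ((I.orderIsoOfFin h).symm ⟨j, hj⟩)
  simpa only [colSel, Matrix.submatrix_apply, id_eq, OrderIso.apply_symm_apply] using hij

/-- If two codewords agree on all but `ρ + 2 * t` columns, they carry the same message. -/
theorem CrissCorrecting.message_eq {K : Type*} [Field K] {M n ℓ t ρ : ℕ}
    {CS : Matrix (Fin M) (Fin ℓ) K → Set (Matrix (Fin M) (Fin n) K)}
    (hcorr : CrissCorrecting t ρ CS) (htρ : 2 * t + ρ ≤ n)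
    {I : Finset (Fin n)} (hI : I.card = n - (ρ + 2 * t))
    {S T : Matrix (Fin M) (Fin ℓ) K} {C C' : Matrix (Fin M) (Fin n) K}
    (hC : C ∈ CS S) (hC' : C' ∈ CS T) (hagree : ∀ i, ∀ j ∈ I, C i j = C' i j) : S = T := by
  classical
  have hcompl : Iᶜ.card = n - I.card := by simp [Finset.card_compl]
  obtain ⟨J, hJ, hJc⟩ := Finset.exists_subset_card_eq (s := Iᶜ) (n := t) (by omega)
  have hsdiff : (Iᶜ \ J).card = Iᶜ.card - J.card := Finset.card_sdiff_of_subset hJ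
  obtain ⟨R, hR, hRc⟩ := Finset.exists_subset_card_eq (s := Iᶜ \ J) (n := t) (by omega)
  have hIJ : Disjoint I J := Finset.disjoint_left.mpr fun x hx hxJ => by
    simpa [hx] using hJ hxJ
  have hIJR : Disjoint (I ∪ J) R := Finset.disjoint_left.mpr fun x hx hxR => by
    have := hR hxR
    simp only [Finset.mem_sdiff, Finset.mem_compl, Finset.mem_union] at this hx
    tauto
  have hL : (I ∪ J ∪ R).card = n - ρ := by
    rw [Finset.card_union_of_disjoint hIJR, Finset.card_union_of_disjoint hIJ]
    omega
  obtain ⟨D, hD⟩ := hcorr _ hL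
  let A : Matrix (Fin M) (Fin n) K := Matrix.of fun i j => if j ∈ J then C' i j - C i j else 0
  let B : Matrix (Fin M) (Fin n) K := Matrix.of fun i j => if j ∈ R then C i j - C' i j else 0
  have hA : ∀ i j, A i j ≠ 0 → j ∈ J := fun i j hij => by
    by_contra hj
    simp [A, hj] at hij
  have hB : ∀ i j, B i j ≠ 0 → j ∈ R := fun i j hij => by
    by_contra hj
    simp [B, hj] at hij
  have hword : colSel _ hL C + colSel _ hL A = colSel _ hL C' + colSel _ hL B := by
    ext i k
    have hk := ((I ∪ J ∪ R).orderIsoOfFin hL k).2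
    simp only [colSel, Matrix.add_apply, Matrix.submatrix_apply, Matrix.of_apply, id_eq, A, B]
    generalize (((I ∪ J ∪ R).orderIsoOfFin hL k : _) : Fin n) = j at hk ⊢
    have hdJ : j ∈ R → j ∉ J := fun h => (Finset.mem_sdiff.mp (hR h)).2
    have hag := hagree i j
    by_cases hjR : j ∈ R
    · simp [hjR, hdJ hjR]
    · by_cases hjJ : j ∈ J
      · simp [hjR, hjJ]
      · have hjI : j ∈ I := by simpa [hjR, hjJ] using hk
        simp [hjR, hjJ, hag hjI]
  rw [← hD S C _ hC ((wtc_colSel_le _ hL J hA).trans hJc.le), hword,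
    hD T C' _ hC' ((wtc_colSel_le _ hL R hB).trans hRc.le)]

/-- a crisscross `t`-error and `ρ`-erasure-correcting scheme is crisscross
`0`-error and `(ρ + 2t)`-erasure-correcting. -/
theorem stmt13 {Fq : Type*} [Field Fq] [Fintype Fq]
    (q M n ℓ t ρ : ℕ) (hq : IsPrimePow q) (hcq : Fintype.card Fq = q)
    (hM : 0 < M) (hn : 0 < n) (hℓ : 0 < ℓ) (htρ : 2 * t + ρ ≤ n)
    (CS : Matrix (Fin M) (Fin ℓ) Fq → Set (Matrix (Fin M) (Fin n) Fq))
    (hne : ∀ S, (CS S).Nonempty)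
    (hdisj : ∀ S T, S ≠ T → Disjoint (CS S) (CS T))
    (hcorr : CrissCorrecting t ρ CS) :
    CrissCorrecting 0 (ρ + 2 * t) CS := by
  classical
  intro I hI
  refine ⟨fun W => if h : ∃ S, ∃ C ∈ CS S, colSel I hI C = W then h.choose else 0,
    fun S C E hC hE => ?_⟩
  rw [eq_zero_of_wtc_le_zero hE, add_zero]
  have h : ∃ T, ∃ C' ∈ CS T, colSel I hI C' = colSel I hI C := ⟨S, C, hC, rfl⟩
  simp only [dif_pos h]
  obtain ⟨C', hC', heq⟩ := h.choose_spec
  exact hcorr.message_eq htρ hI hC' hC fun i j hj => eq_of_colSel_eq heq i hj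
end

section
/- Let q be a prime power and n ≤ m positive integers, let α ≥ 1, and let 0 ≤ k_2 < k_1 ≤ n and t_0, ρ_0 ≥ 0 be integers with 2t_0 + ρ_0 = n − k_1; set ℓ = k_1 − k_2. Let n − ρ_0 = d_h < d_{h−1} < … < d_1 ≤ n be integers and set α = lcm(d_1 − 2t_0 − k_2, …, d_h − 2t_0 − k_2). Then there exists a coset coding scheme (C_S) with message set F_q^{αm×ℓ} and codeword set F_q^{αm×n} such that: (1) for all integers t, ρ ≥ 0 with 2t + ρ ≤ n − k_1, the scheme is crisscross t-error and ρ-erasure-correcting; (2) for every integer μ with 0 ≤ μ ≤ k_2, the scheme is secure under μ column-observations; (3) for every j ∈ {1,…,h} and every I ⊆ {1,…,n} with #I = d_j, there exist preprocessing functions E_{I,i} : F_q^{αm} → F_q^{ℓαm/(d_j − 2t_0 − k_2)} (i = 1,…,d_j) that are t_0-crisscross-error-correcting with respect to the scheme; in particular CO(I) = ℓ(2t_0 + k_2)/(d_j − 2t_0 − k_2), attaining the communication-overhead lower bound with equality. -/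
open Matrix

section LinearizedPolynomials

variable {K L : Type*} [Field K] [Fintype K] [Field L] [Algebra K L]

/-- The map `x ↦ ∑_{i < k} u i * x ^ (q ^ i)` on `L` of a linearized polynomial, `q = #K`. -/
noncomputable def linPoly (K : Type*) {L : Type*} [Field K] [Fintype K] [Field L] [Algebra K L]
    (u : ℕ → L) (k : ℕ) : L →ₗ[K] L :=
  ∑ i ∈ Finset.range k,
    LinearMap.mulLeft K (u i) ∘ₗ (FiniteField.frobeniusAlgHom K L ^ i).toLinearMap

theorem linPoly_apply (u : ℕ → L) (k : ℕ) (x : L) :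
    linPoly K u k x = ∑ i ∈ Finset.range k, u i * x ^ Fintype.card K ^ i := by
  simp [linPoly, LinearMap.sum_apply, AlgHom.coe_pow, FiniteField.coe_frobeniusAlgHom, pow_iterate]

theorem linPoly_sub (u v : ℕ → L) (k : ℕ) (x : L) :
    linPoly K (u - v) k x = linPoly K u k x - linPoly K v k x := by
  simp [linPoly_apply, sub_mul]

theorem linPoly_eq_zero_of_vanish [Finite L] (u : ℕ → L) (k : ℕ) (W : Submodule K L)
    (hk : k ≤ Module.finrank K W) (h : ∀ x ∈ W, linPoly K u k x = 0) : ∀ i < k, u i = 0 := by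
  classical
  have := Fintype.ofFinite L
  have := Fintype.ofFinite W
  have hq : 1 < Fintype.card K := Fintype.one_lt_card
  set p : Polynomial L :=
    ∑ i ∈ Finset.range k, Polynomial.C (u i) * Polynomial.X ^ (Fintype.card K ^ i) with hp
  have hcoeff : ∀ i < k, p.coeff (Fintype.card K ^ i) = u i := by
    intro i hi
    rw [hp, Polynomial.finsetSum_coeff, Finset.sum_eq_single i]
    · simp
    · intro j _ hji
      rw [Polynomial.coeff_C_mul, Polynomial.coeff_X_pow, if_neg, mul_zero]
      exact fun e => hji (Nat.pow_right_injective hq e).symm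
    · simp [hi]
  have hcard : Fintype.card W = Fintype.card K ^ Module.finrank K W := Module.card_eq_pow_finrank
  have hdeg : p.natDegree < Fintype.card W := by
    refine lt_of_lt_of_le ?_ (hcard ▸ Nat.pow_le_pow_right hq.le hk)
    refine Nat.lt_of_le_pred (pow_pos (zero_lt_one.trans hq) k)
      (Polynomial.natDegree_sum_le_of_forall_le _ _ fun i hi => ?_)
    refine (Polynomial.natDegree_C_mul_X_pow_le _ _).trans (Nat.le_pred_of_lt ?_)
    exact Nat.pow_lt_pow_right hq (Finset.mem_range.mp hi)
  have h0 : p = 0 :=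
    Polynomial.eq_zero_of_natDegree_lt_card_of_eval_eq_zero p
      (Subtype.val_injective : Function.Injective (Subtype.val : W → L))
      (fun x => by
        have := h x x.2
        rw [linPoly_apply] at this
        simpa [hp, Polynomial.eval_finsetSum] using this) hdeg
  intro i hi
  rw [← hcoeff i hi, h0, Polynomial.coeff_zero]

theorem linPoly_eq_zero_of_cover [Finite L] (u : ℕ → L) (k : ℕ) {N : ℕ} {g : Fin N → L}
    (hg : LinearIndependent K g) (Y : Finset (Fin N)) (T : Submodule K L)
    (hT : Module.finrank K T + Y.card + k ≤ N) (h : ∀ j ∉ Y, linPoly K u k (g j) ∈ T) :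
    ∀ i < k, u i = 0 := by
  classical
  let gY : {j // j ∉ Y} → L := fun j => g j
  have hgY : LinearIndependent K gY := hg.comp _ Subtype.val_injective
  set W := Submodule.span K (Set.range gY) with hW
  have hWrank : Module.finrank K W = N - Y.card := by
    rw [hW, finrank_span_eq_card hgY, Fintype.card_subtype_compl]
    simp
  have hWT : ∀ x ∈ W, linPoly K u k x ∈ T := by
    intro x hx
    have : W ≤ T.comap (linPoly K u k) := by
      rw [hW, Submodule.span_le]
      rintro _ ⟨j, rfl⟩
      exact h j j.2
    exact this hx
  let φ : W →ₗ[K] T := (linPoly K u k).restrict hWT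
  have h1 := φ.finrank_range_add_finrank_ker
  have h2 : Module.finrank K φ.range ≤ Module.finrank K T := Submodule.finrank_le _
  refine linPoly_eq_zero_of_vanish u k (φ.ker.map W.subtype) ?_ ?_
  · rw [Submodule.finrank_map_subtype_eq]
    omega
  · rintro _ ⟨x, hx, rfl⟩
    exact congrArg Subtype.val (LinearMap.mem_ker.mp hx)

/-- Interpolation by linearized polynomials. -/
theorem exists_linPoly_eq [Finite L] {μ : ℕ} {g : Fin μ → L} (hg : LinearIndependent K g)
    (w : Fin μ → L) : ∃ u : ℕ → L, (∀ i, μ ≤ i → u i = 0) ∧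
      ∀ k, μ ≤ k → ∀ j, linPoly K u k (g j) = w j := by
  let ext (v : Fin μ → L) (i : ℕ) : L := if h : i < μ then v ⟨i, h⟩ else 0
  let φ : (Fin μ → L) →ₗ[L] (Fin μ → L) :=
    { toFun := fun v j => ∑ i, v i * g j ^ Fintype.card K ^ (i : ℕ)
      map_add' := by intros; ext; simp [add_mul, Finset.sum_add_distrib]
      map_smul' := by intros; ext; simp [mul_assoc, Finset.mul_sum] }
  have hφ : ∀ v j, linPoly K (ext v) μ (g j) = φ v j := by
    intro v j
    rw [linPoly_apply, Finset.sum_range]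
    simp [φ, ext]
  have hinj : Function.Injective φ := by
    rw [← LinearMap.ker_eq_bot, LinearMap.ker_eq_bot']
    intro v hv
    have := linPoly_eq_zero_of_cover (ext v) μ hg ∅ ⊥ (by simp)
      (fun j _ => by rw [hφ, hv]; simp)
    ext i
    simpa [ext] using this i i.2
  obtain ⟨v, hv⟩ := (LinearMap.injective_iff_surjective.mp hinj) w
  refine ⟨ext v, fun i hi => dif_neg hi.not_gt, fun k hk j => ?_⟩
  rw [← hv, ← hφ, linPoly_apply, linPoly_apply]
  refine (Finset.sum_subset (Finset.range_mono hk) fun i _ hi => ?_).symm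
  simp only [Finset.mem_range] at hi
  simp [ext, hi]

end LinearizedPolynomials

section Staircase

variable {G : Type*} [AddCommGroup G]

/-- The staircase array after `j + 1` blocks of rows. Rows `A j, …, A (j + 1) - 1` have their
first `D (j + 1)` entries filled with the entries of columns `D (j + 1), …, D j - 1` of the
rows above, and are zero elsewhere. -/
def staircase (A D : ℕ → ℕ) (s : ℕ → G) : ℕ → ℕ → ℕ → G
  | 0, a, c => if c < D 0 then s (c * A 0 + a) else 0
  | j + 1, a, c =>
    if a < A j then staircase A D s j a c
    else if c < D (j + 1) then
      staircase A D s j (((a - A j) * D (j + 1) + c) % A j)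
        (D (j + 1) + ((a - A j) * D (j + 1) + c) / A j)
    else 0

theorem staircase_sub (A D : ℕ → ℕ) (s s' : ℕ → G) (j a c : ℕ) :
    staircase A D (s - s') j a c = staircase A D s j a c - staircase A D s' j a c := by
  induction j generalizing a c with
  | zero => simp only [staircase]; split_ifs <;> simp
  | succ j ih => simp only [staircase, ih]; split_ifs <;> simp

theorem staircase_eq_of_le {A : ℕ → ℕ} (hA : Monotone A) (D : ℕ → ℕ) (s : ℕ → G) {j J : ℕ}
    (hj : j ≤ J) {a : ℕ} (ha : a < A j) (c : ℕ) :
    staircase A D s J a c = staircase A D s j a c := by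
  induction J, hj using Nat.le_induction with
  | base => rfl
  | succ J hJ ih => rw [staircase, if_pos (ha.trans_le (hA hJ)), ih]

theorem staircase_eq_zero {A D : ℕ → ℕ} (hA : Monotone A) (hD : Antitone D) (hA0 : ∀ j, 0 < A j)
    (hAD : ∀ j, A j * D j = A 0 * D 0) (s : ℕ → G) (j : ℕ)
    (h : ∀ a < A j, (∀ c, D j ≤ c → staircase A D s j a c = 0) → ∀ c, staircase A D s j a c = 0) :
    ∀ x < A 0 * D 0, s x = 0 := by
  induction j with
  | zero =>
    intro x hx
    have hc : x / A 0 < D 0 := Nat.div_lt_of_lt_mul hx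
    have := h (x % A 0) (Nat.mod_lt _ (hA0 0))
      (fun c hc => by simp [staircase, hc]) (x / A 0)
    rwa [staircase, if_pos hc, Nat.div_add_mod'] at this
  | succ j ih =>
    refine ih fun a ha hac => ?_
    have hAj : A j ≤ A (j + 1) := hA (Nat.le_succ j)
    have hDj : D (j + 1) ≤ D j := hD (Nat.le_succ j)
    have hz : ∀ c, D (j + 1) ≤ c → staircase A D s j a c = 0 := by
      intro c hc
      by_cases hcD : D j ≤ c
      · exact hac c hcD
      set x := (c - D (j + 1)) * A j + a with hx
      have hpos : 0 < D (j + 1) := by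
        by_contra h0
        have : A j * D j = 0 := by rw [hAD j, ← hAD (j + 1)]; simp_all
        rcases Nat.mul_eq_zero.mp this with h | h
        · exact (hA0 j).ne' h
        · omega
      have hxlt : x < (A (j + 1) - A j) * D (j + 1) := by
        have e : A j * D j = A (j + 1) * D (j + 1) := by rw [hAD j, hAD (j + 1)]
        rw [Nat.sub_mul, ← e, ← Nat.mul_sub]
        calc x < (c - D (j + 1)) * A j + A j := by omega
          _ = A j * (c - D (j + 1) + 1) := by ring
          _ ≤ _ := Nat.mul_le_mul_left _ (by omega)
      have hr : x / D (j + 1) < A (j + 1) - A j := Nat.div_lt_of_lt_mul (by rwa [mul_comm])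
      have hm := Nat.mod_lt x hpos
      have hdm := Nat.div_add_mod' x (D (j + 1))
      generalize x / D (j + 1) = r at hr hdm
      have := h (A j + r) (by omega)
        (fun c' hc' => by rw [staircase, if_neg (by omega), if_neg (by omega)]) (x % D (j + 1))
      rw [staircase, if_neg (by omega), if_pos hm, Nat.add_sub_cancel_left,
        hdm] at this
      have h1 : x % A j = a := by rw [hx, Nat.mul_add_mod', Nat.mod_eq_of_lt ha]
      have h2 : x / A j = c - D (j + 1) := by
        rw [hx, mul_comm, Nat.mul_add_div (hA0 j), Nat.div_eq_of_lt ha, add_zero]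
      rwa [h1, h2, Nat.add_sub_cancel' hc] at this
    have hs : ∀ c, staircase A D s (j + 1) a c = staircase A D s j a c := fun c => by
      rw [staircase, if_pos ha]
    intro c
    rw [← hs]
    exact h a (by omega) (fun c hc => by rw [hs, hz c hc]) c

end Staircase

section Decoding

theorem exists_cover_of_wtc_le {K : Type*} [Zero K] {M N t : ℕ} {E : Matrix (Fin M) (Fin N) K}
    (h : wtc E ≤ t) : ∃ (X : Finset (Fin M)) (Y : Finset (Fin N)),
      (∀ i j, E i j ≠ 0 → i ∈ X ∨ j ∈ Y) ∧ X.card + Y.card ≤ t := by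
  obtain ⟨X, Y, hXY, hc⟩ := Nat.sInf_mem (s := {k | ∃ (X : Finset (Fin M)) (Y : Finset (Fin N)),
    (∀ i j, E i j ≠ 0 → i ∈ X ∨ j ∈ Y) ∧ X.card + Y.card = k})
    ⟨_, Finset.univ, ∅, fun i _ _ => Or.inl (Finset.mem_univ i), rfl⟩
  exact ⟨X, Y, hXY, hc.trans_le h⟩

theorem wtc_zero {K : Type*} [Zero K] {M N : ℕ} : wtc (0 : Matrix (Fin M) (Fin N) K) = 0 :=
  Nat.eq_zero_of_le_zero (Nat.sInf_le ⟨∅, ∅, by simp, rfl⟩)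

theorem exists_decoder_s16 {σ τ : Type*} [Nonempty σ] (P : τ → σ → Prop)
    (h : ∀ y s s', P y s → P y s' → s = s') : ∃ D : τ → σ, ∀ y s, P y s → D y = s := by
  classical
  refine ⟨fun y => if hy : ∃ s, P y s then hy.choose else Classical.arbitrary σ, fun y s hs => ?_⟩
  have hy : ∃ s, P y s := ⟨s, hs⟩
  simp only [dif_pos hy]
  exact h y _ _ hy.choose_spec hs

end Decoding

section Scheme

variable {K L : Type*} [Field K] [Field L] [Algebra K L] {m n ℓ α : ℕ}

/-- A column of length `α * m` over `K`, viewed as `α` elements of an extension of degree `m`. -/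
noncomputable def colEquiv (b : Module.Basis (Fin m) K L) (α : ℕ) :
    (Fin (α * m) → K) ≃ₗ[K] (Fin α → L) :=
  LinearEquiv.funCongrLeft K K finProdFinEquiv ≪≫ₗ LinearEquiv.curry K K (Fin α) (Fin m) ≪≫ₗ
    LinearEquiv.piCongrRight fun _ => b.equivFun.symm

theorem colEquiv_apply (b : Module.Basis (Fin m) K L) (x : Fin (α * m) → K) (a : Fin α) :
    colEquiv b α x a = ∑ i, x (finProdFinEquiv (a, i)) • b i := by
  simp [colEquiv, Module.Basis.equivFun_symm_apply, LinearEquiv.funCongrLeft_apply,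
    LinearMap.funLeft_apply]

/-- The `α * ℓ` symbols of a message over the extension field, listed as a sequence. -/
noncomputable def messageSymbols (b : Module.Basis (Fin m) K L)
    (S : Matrix (Fin (α * m)) (Fin ℓ) K) (x : ℕ) : L :=
  if h : x < α * ℓ then
    colEquiv b α (fun r => S r (finProdFinEquiv.symm ⟨x, h⟩).2) (finProdFinEquiv.symm ⟨x, h⟩).1
  else 0

theorem eq_of_messageSymbols_eq (b : Module.Basis (Fin m) K L)
    {S T : Matrix (Fin (α * m)) (Fin ℓ) K}
    (h : ∀ x < α * ℓ, messageSymbols b S x = messageSymbols b T x) : S = T := by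
  ext r s
  refine congrFun ((colEquiv b α).injective (a₁ := fun r => S r s) (a₂ := fun r => T r s) ?_) r
  ext a
  have hx := (finProdFinEquiv (a, s)).isLt
  have := h _ hx
  simp only [messageSymbols, dif_pos hx, Fin.eta, Equiv.symm_apply_apply] at this
  exact this

/-- The coefficient sequence with `k` leading coefficients from `R`, followed by `u`. -/
def prependCoeffs (k : ℕ) (R u : ℕ → L) (i : ℕ) : L :=
  if i < k then R i else u (i - k)

theorem prependCoeffs_sub (k : ℕ) (R R' u u' : ℕ → L) :
    prependCoeffs k R u - prependCoeffs k R' u' = prependCoeffs k (R - R') (u - u') := by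
  ext i
  simp only [prependCoeffs, Pi.sub_apply]
  split_ifs <;> rfl

variable [Fintype K]

/-- The staircase coset coding scheme: row `a` over the extension field consists of the values
at `g` of the linearized polynomial whose coefficients are `k₂` random symbols followed by row `a`
of the staircase array of the message. -/
def staircaseScheme (b : Module.Basis (Fin m) K L) (g : Fin n → L) (A D : ℕ → ℕ) (k₂ J : ℕ)
    (S : Matrix (Fin (α * m)) (Fin ℓ) K) : Set (Matrix (Fin (α * m)) (Fin n) K) :=
  {C | ∃ R : Fin α → ℕ → L, ∀ a col, colEquiv b α (fun r => C r col) a =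
    linPoly K (prependCoeffs k₂ (R a) (staircase A D (messageSymbols b S) J a)) (k₂ + D 0) (g col)}

theorem staircaseScheme_nonempty (b : Module.Basis (Fin m) K L) (g : Fin n → L) (A D : ℕ → ℕ)
    (k₂ J : ℕ) (S : Matrix (Fin (α * m)) (Fin ℓ) K) :
    (staircaseScheme b g A D k₂ J S).Nonempty :=
  ⟨fun r col => (colEquiv b α).symm (fun a => linPoly K (prependCoeffs k₂ 0
    (staircase A D (messageSymbols b S) J a)) (k₂ + D 0) (g col)) r, fun _ => 0, fun a col => by
      rw [LinearEquiv.apply_symm_apply]⟩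

theorem staircaseScheme_decode [Finite L] (b : Module.Basis (Fin m) K L) {g : Fin n → L}
    (hg : LinearIndependent K g) {A D : ℕ → ℕ} (hA : Monotone A) (hD : Antitone D)
    (hA0 : ∀ j, 0 < A j) (hAD : ∀ j, A j * D j = α * ℓ) {k₂ J : ℕ} (hAJ : A J = α)
    {j : ℕ} (hj : j ≤ J) {N t : ℕ} (hN : 2 * t + (k₂ + D j) ≤ N) {ι : Fin N → Fin n}
    (hι : Function.Injective ι) {S S' : Matrix (Fin (α * m)) (Fin ℓ) K}
    {C C' : Matrix (Fin (α * m)) (Fin n) K} (hC : C ∈ staircaseScheme b g A D k₂ J S)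
    (hC' : C' ∈ staircaseScheme b g A D k₂ J S') {E E' : Matrix (Fin (α * m)) (Fin N) K}
    (hE : wtc E ≤ t) (hE' : wtc E' ≤ t)
    (heq : ∀ r : Fin (α * m), (r : ℕ) < A j * m → ∀ i,
      C r (ι i) + E r i = C' r (ι i) + E' r i) : S = S' := by
  classical
  obtain ⟨R, hR⟩ := hC
  obtain ⟨R', hR'⟩ := hC'
  obtain ⟨X, Y, hXY, ht⟩ := exists_cover_of_wtc_le hE
  obtain ⟨X', Y', hXY', ht'⟩ := exists_cover_of_wtc_le hE'
  set s := messageSymbols b S - messageSymbols b S' with hs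
  suffices h0 : ∀ x < A 0 * D 0, s x = 0 by
    refine eq_of_messageSymbols_eq b fun x hx => sub_eq_zero.mp ?_
    exact h0 x (by rwa [hAD 0])
  refine staircase_eq_zero hA hD hA0 (fun j => (hAD j).trans (hAD 0).symm) s j
    fun a ha hac c => ?_
  have haα : a < α := hAJ ▸ ha.trans_le (hA hj)
  let a' : Fin α := ⟨a, haα⟩
  by_cases hc : D j ≤ c
  · exact hac c hc
  set w := prependCoeffs k₂ (R a' - R' a') (staircase A D s J a) with hw
  have hdiff : ∀ col, linPoly K w (k₂ + D j) (g col) =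
      ∑ i, (C (finProdFinEquiv (a', i)) col - C' (finProdFinEquiv (a', i)) col) • b i := by
    intro col
    have h1 : w = prependCoeffs k₂ (R a') (staircase A D (messageSymbols b S) J a) -
        prependCoeffs k₂ (R' a') (staircase A D (messageSymbols b S') J a) := by
      rw [prependCoeffs_sub, hw]
      congr 1
      ext c
      exact staircase_sub ..
    have h2 : linPoly K w (k₂ + D j) (g col) = linPoly K w (k₂ + D 0) (g col) := by
      rw [linPoly_apply, linPoly_apply]
      refine Finset.sum_subset (Finset.range_mono (Nat.add_le_add_left (hD (Nat.zero_le j)) _))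
        fun i _ hi => ?_
      rw [Finset.mem_range, not_lt] at hi
      rw [hw, prependCoeffs, if_neg (by omega), staircase_eq_of_le hA D s hj ha,
        hac _ (by omega), zero_mul]
    rw [h2, h1, linPoly_sub, ← hR a' col, ← hR' a' col, colEquiv_apply, colEquiv_apply,
      ← Finset.sum_sub_distrib]
    simp_rw [sub_smul]
  let Z : Finset L := (X ∪ X').image fun r => b (finProdFinEquiv.symm r).2
  have hwz := linPoly_eq_zero_of_cover w (k₂ + D j) (hg.comp ι hι) (Y ∪ Y')
    (Submodule.span K (Z : Set L))
    (by
      have h1 := finrank_span_finset_le_card (R := K) Z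
      rw [Set.finrank] at h1
      have h2 : Z.card ≤ _ := Finset.card_image_le
      have h3 := Finset.card_union_le X X'
      have h4 := Finset.card_union_le Y Y'
      omega)
    (fun i hi => by
      rw [Function.comp_apply, hdiff]
      refine Submodule.sum_mem _ fun k _ => ?_
      set r := finProdFinEquiv (a', k) with hr
      have hrlt : (r : ℕ) < A j * m := by
        have : (r : ℕ) = k + m * a := rfl
        rw [this]
        calc (k : ℕ) + m * a < m * (a + 1) := by rw [mul_add]; omega
          _ ≤ m * A j := Nat.mul_le_mul_left _ ha
          _ = A j * m := mul_comm _ _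
      have hCE : C r (ι i) - C' r (ι i) = E' r i - E r i := by
        linear_combination heq r hrlt i
      rw [hCE]
      simp only [Finset.mem_union, not_or] at hi
      by_cases hrX : r ∈ X ∪ X'
      · refine Submodule.smul_mem _ _ (Submodule.subset_span ?_)
        refine Finset.mem_coe.mpr (Finset.mem_image.mpr ⟨r, hrX, ?_⟩)
        rw [hr, Equiv.symm_apply_apply]
      · simp only [Finset.mem_union, not_or] at hrX
        have e : E r i = 0 := by
          by_contra h
          exact (hXY r i h).elim hrX.1 hi.1
        have e' : E' r i = 0 := by
          by_contra h
          exact (hXY' r i h).elim hrX.2 hi.2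
        simp [e, e'])
  have := hwz (k₂ + c) (by omega)
  rwa [hw, prependCoeffs, if_neg (by omega), Nat.add_sub_cancel_left,
    staircase_eq_of_le hA D s hj ha] at this

theorem staircaseScheme_exists_shift [Finite L] (b : Module.Basis (Fin m) K L) {g : Fin n → L}
    (hg : LinearIndependent K g) (A D : ℕ → ℕ) {k₂ J μ : ℕ} (hμ : μ ≤ k₂) {ι : Fin μ → Fin n}
    (hι : Function.Injective ι) (S S' : Matrix (Fin (α * m)) (Fin ℓ) K) :
    ∃ Δ : Matrix (Fin (α * m)) (Fin n) K, (∀ r i, Δ r (ι i) = 0) ∧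
      ∀ C ∈ staircaseScheme b g A D k₂ J S, C - Δ ∈ staircaseScheme b g A D k₂ J S' := by
  let V : ℕ → ℕ → L := fun a => staircase A D (messageSymbols b S) J a -
    staircase A D (messageSymbols b S') J a
  choose u hu0 hu using fun a : Fin α => exists_linPoly_eq (hg.comp ι hι)
    fun i => linPoly K (prependCoeffs k₂ 0 (V a)) (k₂ + D 0) (g (ι i))
  have hcoeff : ∀ a, prependCoeffs k₂ (-u a) (V a) = prependCoeffs k₂ 0 (V a) - u a := by
    intro a
    ext i
    simp only [prependCoeffs, Pi.sub_apply, Pi.neg_apply, Pi.zero_apply]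
    split_ifs with hi
    · simp
    · rw [hu0 a i (by omega), sub_zero]
  refine ⟨fun r col => (colEquiv b α).symm (fun a =>
    linPoly K (prependCoeffs k₂ (-u a) (V a)) (k₂ + D 0) (g col)) r, fun r i => ?_, ?_⟩
  · have : (fun a => linPoly K (prependCoeffs k₂ (-u a) (V a)) (k₂ + D 0) (g (ι i))) = 0 := by
      ext a
      have := hu a (k₂ + D 0) (by omega) i
      rw [Function.comp_apply] at this
      rw [hcoeff, linPoly_sub, this, sub_self, Pi.zero_apply]
    simp only [this, map_zero, Pi.zero_apply]
  · rintro C ⟨R, hR⟩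
    refine ⟨fun a => R a + u a, fun a col => ?_⟩
    have h1 := map_sub (colEquiv b α) (fun r => C r col) ((colEquiv b α).symm fun a =>
      linPoly K (prependCoeffs k₂ (-u a) (V a)) (k₂ + D 0) (g col))
    rw [LinearEquiv.apply_symm_apply] at h1
    refine (congrFun h1 a).trans ?_
    rw [Pi.sub_apply, hR a col, ← linPoly_sub, prependCoeffs_sub]
    simp [V]

theorem staircaseScheme_secure [Finite L] (b : Module.Basis (Fin m) K L) {g : Fin n → L}
    (hg : LinearIndependent K g) (A D : ℕ → ℕ) {k₂ μ : ℕ} (J : ℕ) (hμ : μ ≤ k₂) :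
    ColSecure μ (staircaseScheme (α := α) (ℓ := ℓ) b g A D k₂ J) := by
  intro I hI
  have hι : Function.Injective fun i => (I.orderIsoOfFin hI i : Fin n) :=
    Subtype.val_injective.comp (I.orderIsoOfFin hI).injective
  have key : ∀ S S' : Matrix (Fin (α * m)) (Fin ℓ) K,
      (∀ W, ({X ∈ staircaseScheme b g A D k₂ J S | colSel I hI X = W}).ncard ≤
        ({X ∈ staircaseScheme b g A D k₂ J S' | colSel I hI X = W}).ncard) ∧
      (staircaseScheme b g A D k₂ J S).ncard ≤ (staircaseScheme b g A D k₂ J S').ncard := by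
    intro S S'
    obtain ⟨Δ, hΔ, hmem⟩ := staircaseScheme_exists_shift (J := J) b hg A D hμ hι S S'
    refine ⟨fun W => ?_, ?_⟩
    · refine Set.ncard_le_ncard_of_injOn (· - Δ) ?_ (sub_left_injective.injOn) (Set.toFinite _)
      rintro X ⟨hX, rfl⟩
      refine ⟨hmem X hX, ?_⟩
      ext r i
      simp only [colSel, submatrix_apply, id_eq, Matrix.sub_apply, hΔ, sub_zero]
    · exact Set.ncard_le_ncard_of_injOn (· - Δ) hmem (sub_left_injective.injOn) (Set.toFinite _)
  intro S₁ S₂ W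
  rw [le_antisymm ((key S₁ S₂).1 W) ((key S₂ S₁).1 W),
    le_antisymm (key S₁ S₂).2 (key S₂ S₁).2]

end Scheme

/-- crisscross-optimal coset coding schemes from pairs of Gabidulin codes
(`n ≤ m`), on `(α·m) × n` matrices over `Fq`. Here `d j` is `d_{j+1}` for `j : Fin h`. -/
theorem stmt16 {Fq : Type*} [Field Fq] [Fintype Fq]
    (q m n ℓ k₁ k₂ t₀ ρ₀ h α : ℕ) (hq : IsPrimePow q) (hcq : Fintype.card Fq = q)
    (hm : 0 < m) (hn : 0 < n) (hnm : n ≤ m) (hα : 0 < α) (hh : 1 ≤ h)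
    (hk : k₂ < k₁) (hk₁ : k₁ ≤ n)
    (ht₀ρ₀ : 2 * t₀ + ρ₀ = n - k₁)
    (hℓ : ℓ = k₁ - k₂)
    (d : Fin h → ℕ) (hd_anti : StrictAnti d) (hd_le : d ⟨0, by omega⟩ ≤ n)
    (hd_last : d ⟨h - 1, by omega⟩ = n - ρ₀)
    (hlcm : α = Finset.univ.lcm fun j : Fin h => d j - 2 * t₀ - k₂) :
    ∃ CS : Matrix (Fin (α * m)) (Fin ℓ) Fq → Set (Matrix (Fin (α * m)) (Fin n) Fq),
      (∀ S, (CS S).Nonempty) ∧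
      (∀ S T, S ≠ T → Disjoint (CS S) (CS T)) ∧
      (∀ t ρ : ℕ, 2 * t + ρ ≤ n - k₁ → CrissCorrecting t ρ CS) ∧
      (∀ μ : ℕ, μ ≤ k₂ → ColSecure μ CS) ∧
      (∀ j : Fin h, ∀ (I : Finset (Fin n)) (hI : I.card = d j),
        ∃ β : ℕ, β * (d j - 2 * t₀ - k₂) = ℓ * (α * m) ∧
          ∃ EI : Fin (d j) → (Fin (α * m) → Fq) → (Fin β → Fq),
            CrissPreproc t₀ I hI (b := fun _ => β) EI CS ∧
            ((d j : ℚ) * β / (α * m : ℚ) - ℓ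
              = (ℓ : ℚ) * (2 * (t₀ : ℚ) + (k₂ : ℚ))
                / ((d j : ℚ) - 2 * (t₀ : ℚ) - (k₂ : ℚ)))) := by
  have hh' : ∀ j, min j (h - 1) < h := fun j => by omega
  set D : ℕ → ℕ := fun j => d ⟨min j (h - 1), hh' j⟩ - 2 * t₀ - k₂ with hDdef
  set A : ℕ → ℕ := fun j => α * ℓ / D j with hAdef
  have hlast : ∀ j, n - ρ₀ ≤ d j := fun j =>
    hd_last ▸ hd_anti.antitone (Fin.mk_le_mk.mpr (by omega : (j : ℕ) ≤ h - 1))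
  have hDℓ : ∀ j, ℓ ≤ D j := fun j => by
    have := hlast ⟨min j (h - 1), hh' j⟩
    simp only [hDdef]
    omega
  have hD : Antitone D := fun i j hij => by
    have : d ⟨min j (h - 1), hh' j⟩ ≤ d ⟨min i (h - 1), hh' i⟩ :=
      hd_anti.antitone (Fin.mk_le_mk.mpr (by omega))
    simp only [hDdef]
    omega
  have hDα : ∀ j, D j ∣ α := fun j => by
    rw [hlcm]
    exact Finset.dvd_lcm (f := fun j : Fin h => d j - 2 * t₀ - k₂) (Finset.mem_univ _)
  have hAD : ∀ j, A j * D j = α * ℓ := fun j => Nat.div_mul_cancel ((hDα j).mul_right ℓ)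
  have hℓ0 : 0 < ℓ := by omega
  have hA : Monotone A := fun i j hij => Nat.div_le_div_left (hD hij) (hℓ0.trans_le (hDℓ j))
  have hA0 : ∀ j, 0 < A j := fun j =>
    Nat.pos_of_mul_pos_right (hAD j ▸ Nat.mul_pos hα hℓ0)
  have hDlast : D (h - 1) = ℓ := by
    simp only [hDdef, min_self, hd_last]
    omega
  have hAlast : A (h - 1) = α := by
    simp only [hAdef, hDlast, Nat.mul_div_cancel _ hℓ0]
  obtain ⟨p, hp⟩ := CharP.exists Fq
  have hpp : Fact p.Prime := ⟨CharP.char_is_prime Fq p⟩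
  have : NeZero m := ⟨hm.ne'⟩
  let b := Module.finBasisOfFinrankEq Fq (FiniteField.Extension Fq p m)
    (FiniteField.finrank_extension Fq p m)
  have hg : LinearIndependent Fq (b ∘ Fin.castLE hnm) :=
    b.linearIndependent.comp _ (Fin.castLE_injective hnm)
  have hι : ∀ {N : ℕ} (I : Finset (Fin n)) (hI : I.card = N),
      Function.Injective fun i => (I.orderIsoOfFin hI i : Fin n) := fun I hI =>
    Subtype.val_injective.comp (I.orderIsoOfFin hI).injective
  refine ⟨staircaseScheme b (b ∘ Fin.castLE hnm) A D k₂ (h - 1),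
    staircaseScheme_nonempty _ _ _ _ _ _, fun S T hST => ?_, fun t ρ htρ I hI => ?_,
    fun μ hμ => staircaseScheme_secure b hg A D (h - 1) hμ, fun j I hI => ?_⟩
  · refine Set.disjoint_left.mpr fun C hS hT => hST ?_
    exact staircaseScheme_decode b hg hA hD hA0 hAD hAlast le_rfl (t := 0) (by omega)
      Function.injective_id hS hT (E := 0) (E' := 0) wtc_zero.le wtc_zero.le fun _ _ _ => rfl
  · obtain ⟨Dec, hDec⟩ := exists_decoder_s16
      (fun Z S => ∃ C E, C ∈ staircaseScheme b (b ∘ Fin.castLE hnm) A D k₂ (h - 1) S ∧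
        wtc E ≤ t ∧ Z = colSel I hI C + E)
      (by
        rintro Z S S' ⟨C, E, hC, hE, rfl⟩ ⟨C', E', hC', hE', heq⟩
        exact staircaseScheme_decode b hg hA hD hA0 hAD hAlast le_rfl (by omega) (hι I hI) hC hC'
          hE hE' fun r _ i => congrFun (congrFun heq r) i)
    exact ⟨Dec, fun S C E hC hE => hDec _ S ⟨C, E, hC, hE, rfl⟩⟩
  · have hDj : D j = d j - 2 * t₀ - k₂ := by
      have : min (j : ℕ) (h - 1) = j := by omega
      simp only [hDdef, this, Fin.eta]
    have hdj := hlast j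
    have hjh : (j : ℕ) ≤ h - 1 := by omega
    have hle : A j * m ≤ α * m := Nat.mul_le_mul_right _ (hAlast ▸ hA hjh)
    have hβ : A j * m * (d j - 2 * t₀ - k₂) = ℓ * (α * m) := by
      rw [← hDj, mul_right_comm, hAD]
      ring
    refine ⟨A j * m, hβ, fun _ c r => c (Fin.castLE hle r), ?_, ?_⟩
    · obtain ⟨Dec, hDec⟩ := exists_decoder_s16
        (fun (Z : Fin (d j) → Fin (A j * m) → Fq) S =>
          ∃ C E, C ∈ staircaseScheme b (b ∘ Fin.castLE hnm) A D k₂ (h - 1) S ∧ wtc E ≤ t₀ ∧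
            Z = fun i r => C (Fin.castLE hle r) (I.orderIsoOfFin hI i : Fin n) +
              E (Fin.castLE hle r) i)
        (by
          rintro Z S S' ⟨C, E, hC, hE, rfl⟩ ⟨C', E', hC', hE', heq⟩
          exact staircaseScheme_decode b hg hA hD hA0 hAD hAlast hjh (by omega) (hι I hI) hC hC'
            hE hE' fun r hr i => congrFun (congrFun heq i) ⟨r, hr⟩)
      exact ⟨Dec, fun S C E hC hE => hDec _ S ⟨C, E, hC, hE, rfl⟩⟩
    · have hcast : ((d j - 2 * t₀ - k₂ : ℕ) : ℚ) = (d j : ℚ) - 2 * t₀ - k₂ := by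
        rw [Nat.cast_sub (by omega), Nat.cast_sub (by omega)]
        push_cast
        ring
      have hpos : (d j : ℚ) - 2 * t₀ - k₂ ≠ 0 := by
        rw [← hcast, Nat.cast_ne_zero, ← hDj]
        exact (hℓ0.trans_le (hDℓ j)).ne'
      have hβq : ((A j * m : ℕ) : ℚ) * ((d j : ℚ) - 2 * t₀ - k₂) = ℓ * (α * m) := by
        rw [← hcast]
        exact_mod_cast hβ
      have hα' : (α : ℚ) ≠ 0 := Nat.cast_ne_zero.mpr hα.ne'
      have hm' : (m : ℚ) ≠ 0 := Nat.cast_ne_zero.mpr hm.ne'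
      rw [eq_div_of_mul_eq hpos hβq]
      field_simp
      ring
end

section
/- Let q be a prime power, m, n positive integers, and let C_2 ⊊ C_1 ⊆ F_{q^m}^n be F_{q^m}-linear codes with k_1 = dim(C_1) and k_2 = dim(C_2). Then the relative minimum rank distance satisfies both d_R(C_1, C_2) − 1 ≤ n − k_1 and (n − k_2) · (d_R(C_1, C_2) − 1) ≤ m · (n − k_1); equivalently, d_R(C_1, C_2) ≤ min{ n − k_1, m(n − k_1)/(n − k_2) } + 1. -/
open Matrix

/-- The `Fqm`-row space of a matrix over `Fq`. -/
noncomputable def rowSpace (Fq : Type*) [Field Fq] (Fqm : Type*) [Field Fqm] [Algebra Fq Fqm]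
    {μ n : ℕ} (B : Matrix (Fin μ) (Fin n) Fq) : Submodule Fqm (Fin n → Fqm) :=
  Submodule.span Fqm (Set.range fun i : Fin μ => fun j : Fin n => algebraMap Fq Fqm (B i j))

section RelativeRankDistance

variable {Fq Fqm : Type*} [Field Fq] [Field Fqm] [Algebra Fq Fqm] {n : ℕ}

theorem mem_of_rkVec_lt_dRel {C1 C2 : Set (Fin n → Fqm)} {c : Fin n → Fqm} (hc : c ∈ C1)
    (h : rkVec Fq c < dRel Fq C1 C2) : c ∈ C2 := by
  by_contra hc2
  exact Nat.notMem_of_lt_sInf h ⟨c, hc, hc2, rfl⟩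

theorem dRel_le_rkVec {C1 C2 : Set (Fin n → Fqm)} {c : Fin n → Fqm} (hc : c ∈ C1)
    (hc2 : c ∉ C2) : dRel Fq C1 C2 ≤ rkVec Fq c :=
  Nat.sInf_le ⟨c, hc, hc2, rfl⟩

theorem rkVec_le_of_forall_mem [FiniteDimensional Fq Fqm] {W : Submodule Fq Fqm}
    {c : Fin n → Fqm} (h : ∀ i, c i ∈ W) : rkVec Fq c ≤ Module.finrank Fq W :=
  Submodule.finrank_mono (Submodule.span_le.2 (Set.range_subset_iff.2 h))

/-- Subspaces of every dimension up to that of the whole space exist. -/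
theorem exists_submodule_finrank_eq {K V : Type*} [Field K] [AddCommGroup V] [Module K V]
    [FiniteDimensional K V] (r : ℕ) (hr : r ≤ Module.finrank K V) :
    ∃ W : Submodule K V, Module.finrank K W = r := by
  have h := (Module.finBasis K V).linearIndependent.comp (Fin.castLE hr) (Fin.castLE_injective hr)
  exact ⟨_, (finrank_span_eq_card h).trans (Fintype.card_fin r)⟩

/-- Some standard basis vectors form a basis of the quotient by a given code. -/
theorem exists_linearIndependent_mkQ_single {K : Type*} [Field K] (C : Submodule K (Fin n → K)) :
    ∃ a : Fin (n - Module.finrank K C) → Fin n,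
      LinearIndependent K fun j => C.mkQ (Pi.single (a j) 1) := by
  obtain ⟨κ, a, ha, hspan, hli⟩ := exists_linearIndependent' K
    fun i : Fin n => C.mkQ (Pi.single i 1)
  have : Finite κ := Finite.of_injective a ha
  have := Fintype.ofFinite κ
  have htop : Submodule.span K (Set.range fun i : Fin n => C.mkQ (Pi.single i 1)) = ⊤ := by
    have h := (Pi.basisFun K (Fin n)).span_eq
    have h2 := congrArg (Submodule.map C.mkQ) h
    rw [Submodule.map_span, Submodule.map_top, Submodule.range_mkQ, ← Set.range_comp] at h2
    rw [← h2]
    congr 2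
    ext i
    simp
  have hcard : Fintype.card κ = n - Module.finrank K C := by
    rw [← finrank_span_eq_card hli, hspan, htop, finrank_top, Submodule.finrank_quotient]
    simp
  let e := Fintype.equivFinOfCardEq hcard
  exact ⟨a ∘ e.symm, hli.comp e.symm e.symm.injective⟩

/-- A combination of the chosen unit vectors with small rank cannot lie in `C1`. -/
theorem eq_zero_of_sum_smul_single_mem [FiniteDimensional Fq Fqm] {ι : Type*} [Fintype ι]
    {C1 C2 : Submodule Fqm (Fin n → Fqm)} {a : ι → Fin n}
    (ha : LinearIndependent Fqm fun j => C2.mkQ (Pi.single (a j) 1))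
    {W : Submodule Fq Fqm}
    (hW : Module.finrank Fq W < dRel Fq (C1 : Set (Fin n → Fqm)) (C2 : Set (Fin n → Fqm)))
    {x : ι → Fqm} (hx : ∀ j, x j ∈ W)
    (hx1 : ∑ j, x j • Pi.single (a j) (1 : Fqm) ∈ C1) : x = 0 := by
  have hx2 : ∑ j, x j • Pi.single (a j) (1 : Fqm) ∈ C2 := by
    refine mem_of_rkVec_lt_dRel hx1 (lt_of_le_of_lt (rkVec_le_of_forall_mem fun i => ?_) hW)
    rw [Finset.sum_apply]
    refine Submodule.sum_mem _ fun j _ => ?_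
    by_cases hj : i = a j
    · subst hj
      simpa using hx j
    · simp [hj]
  ext j
  refine Fintype.linearIndependent_iff.1 ha x ?_ j
  rw [← (Submodule.Quotient.mk_eq_zero C2).2 hx2, ← Submodule.mkQ_apply, map_sum]
  simp only [map_smul]

/-- Dimension count: vectors with entries in a subspace of small dimension embed in the quotient
by `C1`. -/
theorem card_mul_finrank_le [FiniteDimensional Fq Fqm] {ι : Type*} [Fintype ι]
    {C1 C2 : Submodule Fqm (Fin n → Fqm)} {a : ι → Fin n}
    (ha : LinearIndependent Fqm fun j => C2.mkQ (Pi.single (a j) 1))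
    {W : Submodule Fq Fqm}
    (hW : Module.finrank Fq W < dRel Fq (C1 : Set (Fin n → Fqm)) (C2 : Set (Fin n → Fqm))) :
    Fintype.card ι * Module.finrank Fq W ≤
      Module.finrank Fq Fqm * (n - Module.finrank Fqm C1) := by
  let g : (ι → Fqm) →ₗ[Fqm] (Fin n → Fqm) ⧸ C1 :=
    C1.mkQ ∘ₗ Fintype.linearCombination Fqm fun j => Pi.single (a j) (1 : Fqm)
  let f : (ι → W) →ₗ[Fq] (Fin n → Fqm) ⧸ C1 :=
    (g.restrictScalars Fq) ∘ₗ W.subtype.compLeft ι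
  have hf : Function.Injective f := by
    rw [injective_iff_map_eq_zero]
    intro x hx
    have h := eq_zero_of_sum_smul_single_mem ha hW (x := fun j => (x j : Fqm))
      (fun j => (x j).2) ((Submodule.Quotient.mk_eq_zero C1).1 hx)
    ext j
    exact congrFun h j
  have : Module.Finite Fq ((Fin n → Fqm) ⧸ C1) := Module.Finite.trans Fqm _
  have h := LinearMap.finrank_le_finrank_of_injective hf
  rw [Module.finrank_pi_fintype, ← Module.finrank_mul_finrank Fq Fqm ((Fin n → Fqm) ⧸ C1),
    Submodule.finrank_quotient] at h
  simpa using h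

/-- Dimension count: vectors with few nonzero entries embed in the quotient by `C1`. -/
theorem card_le_of_card_lt_dRel [FiniteDimensional Fq Fqm] {ι : Type*} [Fintype ι]
    {C1 C2 : Submodule Fqm (Fin n → Fqm)} {a : ι → Fin n}
    (ha : LinearIndependent Fqm fun j => C2.mkQ (Pi.single (a j) 1))
    (hι : Fintype.card ι < dRel Fq (C1 : Set (Fin n → Fqm)) (C2 : Set (Fin n → Fqm))) :
    Fintype.card ι ≤ n - Module.finrank Fqm C1 := by
  let g : (ι → Fqm) →ₗ[Fqm] (Fin n → Fqm) ⧸ C1 :=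
    C1.mkQ ∘ₗ Fintype.linearCombination Fqm fun j => Pi.single (a j) (1 : Fqm)
  have hg : Function.Injective g := by
    rw [injective_iff_map_eq_zero]
    intro x hx
    exact eq_zero_of_sum_smul_single_mem ha (lt_of_le_of_lt (finrank_range_le_card x) hι)
      (fun j => Submodule.subset_span ⟨j, rfl⟩) ((Submodule.Quotient.mk_eq_zero C1).1 hx)
  have h := LinearMap.finrank_le_finrank_of_injective hg
  rw [Submodule.finrank_quotient] at h
  simpa using h

end RelativeRankDistance

/-- the Singleton bound on the relative minimum rank distance:
`d_R(C1,C2) − 1 ≤ n − k₁` and `(n − k₂)(d_R(C1,C2) − 1) ≤ m(n − k₁)`. -/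
theorem stmt19 {Fq Fqm : Type*} [Field Fq] [Field Fqm] [Algebra Fq Fqm]
    [Fintype Fq] [Fintype Fqm]
    (q m n k₁ k₂ : ℕ) (hq : IsPrimePow q) (hm : 0 < m) (hn : 0 < n)
    (hcq : Fintype.card Fq = q) (hcqm : Fintype.card Fqm = q ^ m)
    (C1 C2 : Submodule Fqm (Fin n → Fqm)) (hsub : C2 < C1)
    (hk₁ : k₁ = Module.finrank Fqm ↥C1) (hk₂ : k₂ = Module.finrank Fqm ↥C2) :
    dRel Fq (C1 : Set (Fin n → Fqm)) (C2 : Set (Fin n → Fqm)) - 1 ≤ n - k₁ ∧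
    (n - k₂) * (dRel Fq (C1 : Set (Fin n → Fqm)) (C2 : Set (Fin n → Fqm)) - 1)
      ≤ m * (n - k₁) := by
  subst hk₁ hk₂
  have : FiniteDimensional Fq Fqm := Module.Finite.of_finite
  have hfr : Module.finrank Fq Fqm = m := by
    have h := Module.card_eq_pow_finrank (K := Fq) (V := Fqm)
    rw [hcqm, hcq] at h
    exact (Nat.pow_right_injective hq.two_le h).symm
  obtain ⟨a, ha⟩ := exists_linearIndependent_mkQ_single C2
  obtain ⟨c, hc1, hc2⟩ := SetLike.exists_of_lt hsub
  have hdm := (dRel_le_rkVec (Fq := Fq) (C1 := (C1 : Set (Fin n → Fqm)))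
    (C2 := (C2 : Set (Fin n → Fqm))) hc1 hc2).trans (Submodule.finrank_le _)
  have hlt := Submodule.finrank_lt_finrank_of_lt hsub
  have hle : Module.finrank Fqm C1 ≤ n := by simpa using Submodule.finrank_le C1
  rcases Nat.eq_zero_or_pos
    (dRel Fq (C1 : Set (Fin n → Fqm)) (C2 : Set (Fin n → Fqm))) with hd | hd
  · simp [hd]
  constructor
  · let t := min (dRel Fq (C1 : Set (Fin n → Fqm)) (C2 : Set (Fin n → Fqm)) - 1)
      (n - Module.finrank Fqm C2)
    have ht : t ≤ n - Module.finrank Fqm C2 := min_le_right _ _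
    have h := card_le_of_card_lt_dRel (Fq := Fq) (C1 := C1)
      (ha.comp (Fin.castLE ht) (Fin.castLE_injective ht)) (by simp only [Fintype.card_fin]; omega)
    rw [Fintype.card_fin] at h
    omega
  · obtain ⟨W, hW⟩ := exists_submodule_finrank_eq (K := Fq) (V := Fqm)
      (dRel Fq (C1 : Set (Fin n → Fqm)) (C2 : Set (Fin n → Fqm)) - 1) (by omega)
    have h := card_mul_finrank_le (C1 := C1) ha (W := W) (by omega)
    rwa [Fintype.card_fin, hW, hfr] at h
end
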